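/- arXiv:1311.7575 — 3 statements merged into one kernel-verified Lean document; each statement's English description precedes it below -/
import Mathlib

section
/- Let X and Y be pointed metric spaces, let s, p, r ∈ [1,∞] with p ≤ s and r ≤ p, and let s' and p' be the conjugate exponents of s and p. For a Lipschitz map S : X → Y the following are equivalent: (1) S is Lipschitz (m^L(s;p),r)-summing; (2) for every Banach space G the induced linear map S_G from the G-valued molecules on X with the norm cs_{p',r} to the G-valued molecules on Y with the norm cs_{s'} is bounded; (3) the same holds for G = ℓ_{s'}. In this case π^L_{(m^L(s;p),r)}(S) = ‖S_{ℓ_{s'}} : CS_{p',r}(X,ℓ_{s'}) → CS_{s'}(Y,ℓ_{s'})‖ and this quantity dominates ‖S_G : CS_{p',r}(X,G) → CS_{s'}(Y,G)‖ for every Banach space G. -/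
open MeasureTheory ENNReal NNReal

noncomputable section

/-- The closed unit ball `B_{X^#}` of the Lipschitz dual of a pointed metric space `(X, x₀)`:
all Lipschitz functions `f : X → ℝ` with `f x₀ = 0` and Lipschitz constant at most `1`. -/
def dualBall (X : Type*) [MetricSpace X] (x₀ : X) : Set (X → ℝ) :=
  {f | LipschitzWith 1 f ∧ f x₀ = 0}

/-- The strong `ℓ_p` norm `‖(σ,x',x'')|ℓ_p‖ = (Σ_j |σ_j|^p d(x'_j,x''_j)^p)^{1/p}`
(with the sup for `p = ∞`). -/
def strongNorm {X : Type*} [MetricSpace X] (p : ℝ≥0∞) {m : ℕ}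
    (σ : Fin m → ℝ) (x' x'' : Fin m → X) : ℝ≥0∞ :=
  eLpNorm (fun j => σ j * dist (x' j) (x'' j)) p Measure.count

/-- The weak Lipschitz `ℓ_p` norm
`‖(σ,x',x'')|ℓ_p^{L,w}‖ = sup_{f ∈ B_{X^#}} (Σ_j |σ_j|^p |f(x'_j) - f(x''_j)|^p)^{1/p}`. -/
def weakNorm {X : Type*} [MetricSpace X] (x₀ : X) (p : ℝ≥0∞) {m : ℕ}
    (σ : Fin m → ℝ) (x' x'' : Fin m → X) : ℝ≥0∞ :=
  ⨆ f ∈ dualBall X x₀, eLpNorm (fun j => σ j * (f (x' j) - f (x'' j))) p Measure.count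

/-- The `q`-conjugate index `s'(q)`, determined by `1/s'(q) = 1/q - 1/s`. -/
def conjIdx (q s : ℝ≥0∞) : ℝ≥0∞ := (1 / q - 1 / s)⁻¹

/-- The Lipschitz mixed `(s;q)`-norm
`m^L_{(s;q)}(σ,x',x'') = inf ‖τ|ℓ_{s'(q)}‖ ⬝ ‖(σ/τ,x',x'')|ℓ_s^{L,w}‖`,
the infimum over all finite sequences `τ` of nonzero reals. -/
def mixedNorm {X : Type*} [MetricSpace X] (x₀ : X) (s q : ℝ≥0∞) {m : ℕ}
    (σ : Fin m → ℝ) (x' x'' : Fin m → X) : ℝ≥0∞ :=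
  ⨅ (τ : Fin m → ℝ) (_ : ∀ j, τ j ≠ 0),
    eLpNorm τ (conjIdx q s) Measure.count * weakNorm x₀ s (fun j => σ j / τ j) x' x''

/-- `T` is Lipschitz `(m^L(s;q),p)`-summing:
`m^L_{(s;q)}(σ,Tx',Tx'') ≤ C ⬝ ‖(σ,x',x'')|ℓ_p^{L,w}‖` for all finite sequences. -/
def LipMixedP {X Y : Type*} [MetricSpace X] [MetricSpace Y] (x₀ : X) (y₀ : Y)
    (s q p : ℝ≥0∞) (T : X → Y) : Prop :=
  ∃ C : ℝ≥0, ∀ (m : ℕ) (σ : Fin m → ℝ) (x' x'' : Fin m → X),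
    mixedNorm y₀ s q σ (T ∘ x') (T ∘ x'') ≤ C * weakNorm x₀ p σ x' x''

/-- The norm `π^L_{(m^L(s;q),p)}(T)`, the least constant in the defining inequality. -/
def lipMixedPNorm {X Y : Type*} [MetricSpace X] [MetricSpace Y] (x₀ : X) (y₀ : Y)
    (s q p : ℝ≥0∞) (T : X → Y) : ℝ≥0∞ :=
  sInf {C : ℝ≥0∞ | ∀ (m : ℕ) (σ : Fin m → ℝ) (x' x'' : Fin m → X),
    mixedNorm y₀ s q σ (T ∘ x') (T ∘ x'') ≤ C * weakNorm x₀ p σ x' x''}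

/-- `T` is Lipschitz `(p,m^L(s;q))`-summing:
`‖(σ,Tx',Tx'')|ℓ_p‖ ≤ C ⬝ m^L_{(s;q)}(σ,x',x'')` for all finite sequences. -/
def LipPMixed {X Y : Type*} [MetricSpace X] [MetricSpace Y] (x₀ : X)
    (p s q : ℝ≥0∞) (T : X → Y) : Prop :=
  ∃ C : ℝ≥0, ∀ (m : ℕ) (σ : Fin m → ℝ) (x' x'' : Fin m → X),
    strongNorm p σ (T ∘ x') (T ∘ x'') ≤ C * mixedNorm x₀ s q σ x' x''

/-- The norm `π^L_{(p,m^L(s;q))}(T)`, the least constant in the defining inequality. -/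
def lipPMixedNorm {X Y : Type*} [MetricSpace X] [MetricSpace Y] (x₀ : X)
    (p s q : ℝ≥0∞) (T : X → Y) : ℝ≥0∞ :=
  sInf {C : ℝ≥0∞ | ∀ (m : ℕ) (σ : Fin m → ℝ) (x' x'' : Fin m → X),
    strongNorm p σ (T ∘ x') (T ∘ x'') ≤ C * mixedNorm x₀ s q σ x' x''}

/-- The Lipschitz constant of a map, as an element of `ℝ≥0∞` (equal to `∞` if the map is
not Lipschitz). -/
def lipConst {α β : Type*} [PseudoEMetricSpace α] [PseudoEMetricSpace β] (f : α → β) : ℝ≥0∞ :=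
  ⨅ (K : ℝ≥0) (_ : LipschitzWith K f), (K : ℝ≥0∞)


/-- The conjugate exponent `p'` with `1/p + 1/p' = 1`. -/
def conjExp (p : ℝ≥0∞) : ℝ≥0∞ := (1 - 1 / p)⁻¹

/-- The set of `E`-valued molecules on `X`: finitely supported functions summing to `0`. -/
def molecules (X : Type*) (E : Type*) [NormedAddCommGroup E] : Set (X →₀ E) :=
  {mo | mo.sum (fun _ v => v) = 0}

/-- The Chevet–Saphar-type norm
`cs_{a,b}(m) = inf ‖(σ_j ‖v_j‖)_j | ℓ_a‖ ⬝ ‖(σ⁻¹,x',x'') | ℓ_b^{L,w}‖`,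
the infimum over all representations `m = Σ_j v_j (χ_{x'_j} - χ_{x''_j})` with `σ_j ≠ 0`.
For `a = p'`, `b = p` this is the classical norm `cs_{p'}`, and for `a = p'`, `b = r`
it is `cs_{p',r}`. -/
def csNorm {X E : Type*} [MetricSpace X] [NormedAddCommGroup E] (x₀ : X)
    (a b : ℝ≥0∞) (mo : X →₀ E) : ℝ≥0∞ :=
  ⨅ (k : ℕ) (v : Fin k → E) (x' : Fin k → X) (x'' : Fin k → X) (σ : Fin k → ℝ)
    (_ : ∀ j, σ j ≠ 0)
    (_ : mo = ∑ j, (Finsupp.single (x' j) (v j) - Finsupp.single (x'' j) (v j))),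
    eLpNorm (fun j => σ j * ‖v j‖) a Measure.count *
      weakNorm x₀ b (fun j => (σ j)⁻¹) x' x''

/-- The linear map induced by `S : X → Y` on `E`-valued molecules,
`S_E(Σ_j v_j m_{x'_j x''_j}) = Σ_j v_j m_{Sx'_j Sx''_j}`. -/
def molMap {X Y E : Type*} [NormedAddCommGroup E] (S : X → Y) (mo : X →₀ E) : Y →₀ E :=
  Finsupp.mapDomain S mo

/-- `S_E : CS_{a₁,b₁}(X,E) → CS_{a₂,b₂}(Y,E)` is a bounded operator. -/
def molBounded (E : Type*) [NormedAddCommGroup E] {X Y : Type*} [MetricSpace X]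
    [MetricSpace Y] (x₀ : X) (y₀ : Y) (a₁ b₁ a₂ b₂ : ℝ≥0∞) (S : X → Y) : Prop :=
  ∃ B : ℝ≥0, ∀ mo : X →₀ E, mo ∈ molecules X E →
    csNorm y₀ a₂ b₂ (molMap S mo) ≤ B * csNorm x₀ a₁ b₁ mo

/-- The operator norm of `S_E : CS_{a₁,b₁}(X,E) → CS_{a₂,b₂}(Y,E)`. -/
def molOpNorm (E : Type*) [NormedAddCommGroup E] {X Y : Type*} [MetricSpace X]
    [MetricSpace Y] (x₀ : X) (y₀ : Y) (a₁ b₁ a₂ b₂ : ℝ≥0∞) (S : X → Y) : ℝ≥0∞ :=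
  sInf {B : ℝ≥0∞ | ∀ mo : X →₀ E, mo ∈ molecules X E →
    csNorm y₀ a₂ b₂ (molMap S mo) ≤ B * csNorm x₀ a₁ b₁ mo}
lemma eLp_fin {n : ℕ} (f : Fin n → ℝ) {p : ℝ≥0∞} (h0 : p ≠ 0) (ht : p ≠ ⊤) :
    eLpNorm f p Measure.count = (∑ j, ‖f j‖ₑ ^ p.toReal) ^ (1 / p.toReal) := by
  rw [eLpNorm_eq_lintegral_rpow_enorm_toReal h0 ht, lintegral_count, tsum_fintype]

lemma eLp_top {n : ℕ} (f : Fin n → ℝ) :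
    eLpNorm f ⊤ Measure.count = ⨆ j, ‖f j‖ₑ := by
  rw [eLpNorm_exponent_top, eLpNormEssSup_count]

lemma eLp_lt_top {n : ℕ} (f : Fin n → ℝ) (p : ℝ≥0∞) : eLpNorm f p Measure.count < ⊤ :=
  eLpNorm_count_lt_top_of_lt (by simp)

lemma eLp_mono {n : ℕ} {f g : Fin n → ℝ} (p : ℝ≥0∞) (h : ∀ j, |f j| ≤ |g j|) :
    eLpNorm f p Measure.count ≤ eLpNorm g p Measure.count :=
  eLpNorm_mono h

lemma conjExp_holder {s : ℝ≥0∞} (hs : 1 ≤ s) : ENNReal.HolderTriple (conjExp s) s 1 := by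
  constructor
  simp only [conjExp, inv_inv, one_div, inv_one]
  exact tsub_add_cancel_of_le (by simpa using hs)

lemma conj_holder {s p : ℝ≥0∞} (hp : 1 ≤ p) (hps : p ≤ s) :
    ENNReal.HolderTriple (conjIdx p s) (conjExp p) (conjExp s) := by
  constructor
  simp only [conjExp, conjIdx, inv_inv, one_div]
  rw [add_comm]
  exact tsub_add_tsub_cancel (by simpa using hp) (by simpa using hps)

lemma eLp_one {n : ℕ} (f : Fin n → ℝ) :
    eLpNorm f 1 Measure.count = ∑ j, ‖f j‖ₑ := by
  rw [eLp_fin f (by simp) (by simp)]; simp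

lemma holder_mul {n : ℕ} {a b c : ℝ≥0∞} (h : ENNReal.HolderTriple a b c) (u v : Fin n → ℝ) :
    eLpNorm (fun j => u j * v j) c Measure.count ≤
      eLpNorm u a Measure.count * eLpNorm v b Measure.count := by
  have := eLpNorm_smul_le_mul_eLpNorm (p := a) (q := b) (r := c) (μ := Measure.count)
    (f := v) (φ := u) (by fun_prop) (by fun_prop)
  exact this

lemma holder_sum {n : ℕ} {s : ℝ≥0∞} (hs : 1 ≤ s) (u v : Fin n → ℝ) :
    ∑ j, ‖u j‖ₑ * ‖v j‖ₑ ≤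
      eLpNorm u (conjExp s) Measure.count * eLpNorm v s Measure.count := by
  refine le_trans ?_ (holder_mul (conjExp_holder hs) u v)
  rw [eLp_one]; simp [enorm_mul]

lemma duality {n : ℕ} {s : ℝ≥0∞} (hs : 1 ≤ s) (b : Fin n → ℝ) :
    ∃ v : Fin n → ℝ, eLpNorm v (conjExp s) Measure.count ≤ 1 ∧
      ∑ j, v j * b j = (eLpNorm b s Measure.count).toReal := by
  rcases eq_or_ne s ⊤ with rfl | hst
  · have hc : conjExp ⊤ = 1 := by simp [conjExp]
    rw [hc]
    simp only [eLp_one, eLp_top]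
    rcases Nat.eq_zero_or_pos n with rfl | hn
    · exact ⟨0, by simp⟩
    · have : Nonempty (Fin n) := ⟨⟨0, hn⟩⟩
      obtain ⟨i, hi⟩ := exists_eq_ciSup_of_finite (f := fun j => ‖b j‖ₑ)
      refine ⟨Pi.single i (SignType.sign (b i) : ℝ), ?_, ?_⟩
      · rw [Finset.sum_eq_single i]
        · simp only [Pi.single_eq_same]
          rcases lt_trichotomy (b i) 0 with h | h | h <;> simp [h]
        · intro j _ hj; simp [hj]
        · simp
      · rw [← hi, Finset.sum_eq_single i]
        · simp
        · intro j _ hj; simp [hj]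
        · simp
  rcases eq_or_ne s 1 with rfl | hs1
  · have hc : conjExp 1 = ⊤ := by simp [conjExp]
    rw [hc]
    simp only [eLp_one, eLp_top]
    refine ⟨fun j => (SignType.sign (b j) : ℝ), ?_, ?_⟩
    · refine iSup_le fun i => ?_
      rcases lt_trichotomy (b i) 0 with h | h | h <;> simp [h]
    · rw [ENNReal.toReal_sum (by simp)]
      simp
  · have h1 : 1 < s := lt_of_le_of_ne hs (Ne.symm hs1)
    have h1r : 1 < s.toReal := by
      rw [← ENNReal.toReal_one]; exact (ENNReal.toReal_lt_toReal (by simp) hst).2 h1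
    have hc : (conjExp s).toReal = s.toReal.conjExponent := by
      unfold conjExp Real.conjExponent
      rw [ENNReal.toReal_inv, ENNReal.toReal_sub_of_le (by simpa using hs) (by simp)]
      simp
      field_simp
    have hc0 : conjExp s ≠ 0 := by
      simp [conjExp, ENNReal.sub_eq_top_iff]
    have hct : conjExp s ≠ ⊤ := by
      simp [conjExp, tsub_eq_zero_iff_le, h1]
    have hpq : s.toReal.HolderConjugate (conjExp s).toReal := by
      rw [hc]; exact Real.HolderConjugate.conjExponent h1r
    obtain ⟨⟨g, hg, hgs⟩, -⟩ := NNReal.isGreatest_Lp Finset.univ (fun j => ‖b j‖₊) hpq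
    refine ⟨fun j => SignType.sign (b j) * (g j : ℝ), ?_, ?_⟩
    · rw [eLp_fin _ hc0 hct]
      refine ENNReal.rpow_le_one ?_ (by positivity)
      have hg' : ∑ j, (g j : ℝ≥0∞) ^ (conjExp s).toReal ≤ 1 := by
        have : ((∑ j, g j ^ (conjExp s).toReal : ℝ≥0) : ℝ≥0∞) ≤ 1 := by exact_mod_cast hg
        refine le_trans (le_of_eq ?_) this
        push_cast
        refine Finset.sum_congr rfl fun j _ => ?_
        rw [ENNReal.coe_rpow_of_nonneg _ (by positivity)]
      refine le_trans (Finset.sum_le_sum fun j _ => ?_) hg'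
      refine ENNReal.rpow_le_rpow ?_ (by positivity)
      rw [enorm_mul]
      rcases lt_trichotomy (b j) 0 with h | h | h <;> simp [h]
    · have hbs : eLpNorm b s Measure.count =
          (((∑ j, ‖b j‖₊ ^ s.toReal) ^ (1 / s.toReal) : ℝ≥0) : ℝ≥0∞) := by
        rw [eLp_fin _ (by positivity) hst]
        rw [ENNReal.coe_rpow_of_nonneg _ (by positivity)]
        push_cast
        congr 1
        refine Finset.sum_congr rfl fun j _ => ?_
        rw [ENNReal.coe_rpow_of_nonneg _ (by positivity)]; rfl
      rw [hbs, ← hgs]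
      simp only [ENNReal.coe_toReal]
      push_cast
      refine Finset.sum_congr rfl fun j _ => ?_
      rw [Real.norm_eq_abs]
      have := sign_mul_self (b j)
      calc _ = (SignType.sign (b j) * b j : ℝ) * g j := by ring
        _ = _ := by rw [this]

lemma eLp_le_iff {n : ℕ} (f : Fin n → ℝ) {p : ℝ≥0∞} (h0 : p ≠ 0) (ht : p ≠ ⊤) (W : ℝ≥0∞) :
    eLpNorm f p Measure.count ≤ W ↔ ∑ j, ‖f j‖ₑ ^ p.toReal ≤ W ^ p.toReal := by
  rw [eLp_fin f h0 ht, one_div, ENNReal.rpow_inv_le_iff (ENNReal.toReal_pos h0 ht)]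

lemma eLp_rpow {n : ℕ} (f : Fin n → ℝ) {p : ℝ≥0∞} (h0 : p ≠ 0) (ht : p ≠ ⊤) :
    eLpNorm f p Measure.count ^ p.toReal = ∑ j, ‖f j‖ₑ ^ p.toReal := by
  rw [eLp_fin f h0 ht, one_div, ENNReal.rpow_inv_rpow (ENNReal.toReal_pos h0 ht).ne']

lemma enorm_toReal' {a : ℝ≥0∞} (h : a ≠ ⊤) : ‖a.toReal‖ₑ = a := by
  rw [Real.enorm_of_nonneg ENNReal.toReal_nonneg, ENNReal.ofReal_toReal h]

lemma lp_restrict {q : ℝ≥0∞} [hqf : Fact (1 ≤ q)] (w : lp (fun _ : ℕ => ℝ) q) (n : ℕ) :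
    eLpNorm (fun k : Fin n => w k) q Measure.count ≤ ‖w‖ₑ := by
  have hq := hqf.out
  have h0 : q ≠ 0 := (lt_of_lt_of_le one_pos hq).ne'
  rcases eq_or_ne q ⊤ with rfl | ht
  · rw [eLp_top]
    refine iSup_le fun k => ?_
    rw [enorm_le_iff_norm_le]
    exact lp.norm_apply_le_norm h0 w k
  · rw [eLp_le_iff _ h0 ht]
    have hpos := ENNReal.toReal_pos h0 ht
    have := lp.sum_rpow_le_norm_rpow hpos w (Finset.range n)
    rw [Finset.sum_range] at this
    have h2 := ENNReal.ofReal_le_ofReal this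
    have hnn : 0 ≤ ‖w‖ := lp.norm_nonneg' w
    rw [ENNReal.ofReal_sum_of_nonneg (fun i _ => by positivity),
      ← ENNReal.ofReal_rpow_of_nonneg hnn hpos.le] at h2
    have h3 : ENNReal.ofReal ‖w‖ = ‖w‖ₑ := ofReal_norm w
    rw [h3] at h2
    refine le_trans (le_of_eq ?_) h2
    refine Finset.sum_congr rfl fun j _ => ?_
    rw [← ENNReal.ofReal_rpow_of_nonneg (norm_nonneg _) hpos.le, ofReal_norm]

lemma lp_embed {q : ℝ≥0∞} (hq : 1 ≤ q) {n : ℕ} (v : Fin n → ℝ) :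
    ∃ w : lp (fun _ : ℕ => ℝ) q, ‖w‖ ≤ (eLpNorm v q Measure.count).toReal ∧
      ∀ k : Fin n, w k = v k := by
  have h0 : q ≠ 0 := (lt_of_lt_of_le one_pos hq).ne'
  let g : ℕ → ℝ := fun i => if h : i < n then v ⟨i, h⟩ else 0
  have hg : ∀ i, n ≤ i → g i = 0 := fun i hi => by simp [g, not_lt.2 hi]
  have hgk : ∀ k : Fin n, g k = v k := fun k => by simp [g]
  have hmem : Memℓp g q := by
    refine Memℓp.of_exponent_ge (memℓp_zero ?_) (by simp)
    refine (Set.finite_lt_nat n).subset fun i hi => ?_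
    by_contra hc
    exact hi (hg i (not_lt.1 hc))
  refine ⟨⟨g, hmem⟩, ?_, hgk⟩
  have hfin := (eLp_lt_top v q).ne
  rcases eq_or_ne q ⊤ with rfl | ht
  · refine lp.norm_le_of_forall_le ENNReal.toReal_nonneg fun i => ?_
    change ‖g i‖ ≤ _
    rcases lt_or_ge i n with hi | hi
    · have h1 : g i = v ⟨i, hi⟩ := by simp [g, hi]
      rw [h1, ← toReal_enorm]
      refine ENNReal.toReal_mono hfin ?_
      exact enorm_le_eLpNorm_count v _ h0
    · rw [hg i hi]; simp
  · have hpos := ENNReal.toReal_pos h0 ht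
    refine lp.norm_le_of_tsum_le hpos ENNReal.toReal_nonneg ?_
    change ∑' i, ‖g i‖ ^ q.toReal ≤ _
    rw [tsum_eq_sum (s := Finset.range n), Finset.sum_range]
    · rw [ENNReal.toReal_rpow, eLp_rpow v h0 ht, ENNReal.toReal_sum (by simp [hpos.le])]
      refine le_of_eq (Finset.sum_congr rfl fun j _ => ?_)
      rw [hgk, ← ENNReal.toReal_rpow, toReal_enorm]
    · intro i hi
      rw [hg i (by simpa using hi)]
      simp [hpos.ne']

lemma le_weakNorm {X : Type*} [MetricSpace X] {x₀ : X} (p : ℝ≥0∞) {m : ℕ}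
    (σ : Fin m → ℝ) (x' x'' : Fin m → X) {f : X → ℝ} (hf : f ∈ dualBall X x₀) :
    eLpNorm (fun j => σ j * (f (x' j) - f (x'' j))) p Measure.count ≤ weakNorm x₀ p σ x' x'' :=
  le_iSup₂ (f := fun (f : X → ℝ) (_ : f ∈ dualBall X x₀) =>
    eLpNorm (fun j => σ j * (f (x' j) - f (x'' j))) p Measure.count) f hf

/-- the `ℓ_s` norm of the weighted differences -/
def dN {Y : Type*} (s : ℝ≥0∞) {n : ℕ} (μ : Fin n → ℝ) (f : Fin n → Y → ℝ) (y y' : Y) : ℝ :=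
  (eLpNorm (fun k => μ k * (f k y - f k y')) s Measure.count).toReal

lemma enorm_dN {Y : Type*} (s : ℝ≥0∞) {n : ℕ} (μ : Fin n → ℝ) (f : Fin n → Y → ℝ) (y y' : Y) :
    ‖dN s μ f y y'‖ₑ = eLpNorm (fun k => μ k * (f k y - f k y')) s Measure.count :=
  enorm_toReal' (eLp_lt_top _ _).ne

lemma dN_weak {Y : Type*} [MetricSpace Y] (y₀ : Y) {s : ℝ≥0∞} (hs : 1 ≤ s) {n : ℕ}
    (μ : Fin n → ℝ) (hμ : eLpNorm μ s Measure.count ≤ 1) (f : Fin n → Y → ℝ)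
    (hf : ∀ k, f k ∈ dualBall Y y₀) {m : ℕ} (τ : Fin m → ℝ) (y' y'' : Fin m → Y) :
    eLpNorm (fun j => τ j * dN s μ f (y' j) (y'' j)) s Measure.count ≤
      weakNorm y₀ s τ y' y'' := by
  have h0 : s ≠ 0 := (lt_of_lt_of_le one_pos hs).ne'
  rcases eq_or_ne s ⊤ with rfl | ht
  · rw [eLp_top]
    refine iSup_le fun j => ?_
    rw [enorm_mul, enorm_dN, eLp_top, ENNReal.mul_iSup]
    refine iSup_le fun k => ?_
    have h1 := (enorm_le_eLpNorm_count μ k h0).trans hμ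
    have h2 := (enorm_le_eLpNorm_count _ j h0).trans (le_weakNorm ⊤ τ y' y'' (hf k))
    rw [enorm_mul] at h2
    calc _ = ‖μ k‖ₑ * (‖τ j‖ₑ * ‖f k (y' j) - f k (y'' j)‖ₑ) := by rw [enorm_mul]; ring
      _ ≤ 1 * weakNorm y₀ ⊤ τ y' y'' := mul_le_mul' h1 h2
      _ = _ := one_mul _
  · rw [eLp_le_iff _ h0 ht]
    have hpos := ENNReal.toReal_pos h0 ht
    rw [eLp_le_iff _ h0 ht, ENNReal.one_rpow] at hμ
    calc _ = ∑ j, ∑ k, ‖μ k‖ₑ ^ s.toReal * ‖τ j * (f k (y' j) - f k (y'' j))‖ₑ ^ s.toReal := by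
          refine Finset.sum_congr rfl fun j _ => ?_
          rw [enorm_mul, enorm_dN, ENNReal.mul_rpow_of_nonneg _ _ hpos.le, eLp_rpow _ h0 ht,
            Finset.mul_sum]
          refine Finset.sum_congr rfl fun k _ => ?_
          rw [enorm_mul, enorm_mul, ENNReal.mul_rpow_of_nonneg _ _ hpos.le,
            ENNReal.mul_rpow_of_nonneg _ _ hpos.le]
          ring
      _ = ∑ k, ‖μ k‖ₑ ^ s.toReal * ∑ j, ‖τ j * (f k (y' j) - f k (y'' j))‖ₑ ^ s.toReal := by
          rw [Finset.sum_comm]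
          simp only [Finset.mul_sum]
      _ ≤ ∑ k, ‖μ k‖ₑ ^ s.toReal * weakNorm y₀ s τ y' y'' ^ s.toReal := by
          refine Finset.sum_le_sum fun k _ => mul_le_mul_right ?_ _
          exact (eLp_le_iff _ h0 ht _).1 (le_weakNorm s τ y' y'' (hf k))
      _ ≤ _ := by
          rw [← Finset.sum_mul]
          exact mul_le_of_le_one_left' hμ

/-- The functional on the molecules. -/
def pair {Y : Type*} (q : ℝ≥0∞) {n : ℕ} (μ : Fin n → ℝ) (f : Fin n → Y → ℝ) (y : Y) :
    lp (fun _ : ℕ => ℝ) q →+ ℝ where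
  toFun w := ∑ k : Fin n, w k * (μ k * f k y)
  map_zero' := by simp
  map_add' a b := by simp [add_mul, Finset.sum_add_distrib]

lemma pair_sub {Y : Type*} (q : ℝ≥0∞) {n : ℕ} (μ : Fin n → ℝ) (f : Fin n → Y → ℝ) (y y' : Y)
    (w : lp (fun _ : ℕ => ℝ) q) :
    pair q μ f y w - pair q μ f y' w = ∑ k : Fin n, w k * (μ k * (f k y - f k y')) := by
  simp only [pair, AddMonoidHom.coe_mk, ZeroHom.coe_mk]
  rw [← Finset.sum_sub_distrib]
  refine Finset.sum_congr rfl fun k _ => by ring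

lemma functional_le {Y : Type*} [MetricSpace Y] (y₀ : Y) {s : ℝ≥0∞} (hs : 1 ≤ s)
    [Fact (1 ≤ conjExp s)] {n : ℕ}
    (μ : Fin n → ℝ) (hμ : eLpNorm μ s Measure.count ≤ 1) (f : Fin n → Y → ℝ)
    (hf : ∀ k, f k ∈ dualBall Y y₀) (mo : Y →₀ lp (fun _ : ℕ => ℝ) (conjExp s)) :
    ‖Finsupp.liftAddHom (pair (conjExp s) μ f) mo‖ₑ ≤ csNorm y₀ (conjExp s) s mo := by
  unfold csNorm
  refine le_iInf fun k => le_iInf fun v => le_iInf fun y' => le_iInf fun y'' => le_iInf fun τ =>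
    le_iInf fun hτ => le_iInf fun hmo => ?_
  subst hmo
  rw [map_sum]
  simp only [map_sub, Finsupp.liftAddHom_apply_single, pair_sub]
  calc _ ≤ ∑ j, ‖∑ i : Fin n, v j i * (μ i * (f i (y' j) - f i (y'' j)))‖ₑ := enorm_sum_le _ _
    _ ≤ ∑ j, ‖τ j * ‖v j‖‖ₑ * ‖(τ j)⁻¹ * dN s μ f (y' j) (y'' j)‖ₑ := by
      refine Finset.sum_le_sum fun j _ => ?_
      calc _ ≤ ∑ i : Fin n, ‖v j i‖ₑ * ‖μ i * (f i (y' j) - f i (y'' j))‖ₑ := by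
            refine (enorm_sum_le _ _).trans (le_of_eq ?_)
            simp [enorm_mul]
        _ ≤ ‖v j‖ₑ * ‖dN s μ f (y' j) (y'' j)‖ₑ := by
            rw [enorm_dN]
            refine (holder_sum hs (fun i : Fin n => v j i) _).trans ?_
            exact mul_le_mul_left (lp_restrict _ _) _
        _ = _ := by
            rw [← enorm_norm (v j), ← enorm_mul, ← enorm_mul]
            congr 1
            have := hτ j
            field_simp
    _ ≤ _ := holder_sum hs _ _
    _ ≤ _ := mul_le_mul_right (dN_weak y₀ hs μ hμ f hf _ _ _) _

lemma mol_mem {X E : Type*} [NormedAddCommGroup E] {k : ℕ} (v : Fin k → E) (x' x'' : Fin k → X) :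
    (∑ j, (Finsupp.single (x' j) (v j) - Finsupp.single (x'' j) (v j))) ∈ molecules X E := by
  change Finsupp.liftAddHom (fun _ : X => AddMonoidHom.id E) _ = 0
  rw [map_sum]
  simp only [map_sub, Finsupp.liftAddHom_apply_single]
  simp

lemma molMap_sum {X Y E : Type*} [NormedAddCommGroup E] (S : X → Y) {k : ℕ} (v : Fin k → E)
    (x' x'' : Fin k → X) :
    molMap S (∑ j, (Finsupp.single (x' j) (v j) - Finsupp.single (x'' j) (v j))) =
      ∑ j, (Finsupp.single (S (x' j)) (v j) - Finsupp.single (S (x'' j)) (v j)) := by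
  change Finsupp.mapDomain.addMonoidHom S _ = _
  rw [map_sum]
  simp only [map_sub]
  simp [Finsupp.mapDomain.addMonoidHom, Finsupp.mapDomain_single]

lemma csNorm_le {X E : Type*} [MetricSpace X] [NormedAddCommGroup E] (x₀ : X)
    (a b : ℝ≥0∞) {k : ℕ} (v : Fin k → E) (x' x'' : Fin k → X) (σ : Fin k → ℝ)
    (hσ : ∀ j, σ j ≠ 0) :
    csNorm x₀ a b (∑ j, (Finsupp.single (x' j) (v j) - Finsupp.single (x'' j) (v j))) ≤
    eLpNorm (fun j => σ j * ‖v j‖) a Measure.count *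
      weakNorm x₀ b (fun j => (σ j)⁻¹) x' x'' := by
  unfold csNorm
  exact iInf_le_of_le k <| iInf_le_of_le v <| iInf_le_of_le x' <| iInf_le_of_le x'' <|
    iInf_le_of_le σ <| iInf_le_of_le hσ <| iInf_le_of_le rfl le_rfl

lemma key {X Y : Type*} [MetricSpace X] [MetricSpace Y] (x₀ : X) (y₀ : Y)
    {s p r : ℝ≥0∞} (hs : 1 ≤ s) (hp : 1 ≤ p) [hF : Fact (1 ≤ conjExp s)]
    (S : X → Y) (B : ℝ≥0∞)
    (hB : ∀ mo : X →₀ lp (fun _ : ℕ => ℝ) (conjExp s), mo ∈ molecules X _ →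
      csNorm y₀ (conjExp s) s (molMap S mo) ≤ B * csNorm x₀ (conjExp p) r mo)
    {m : ℕ} (σ : Fin m → ℝ) (hσ : ∀ j, σ j ≠ 0) (x' x'' : Fin m → X) {n : ℕ}
    (μ : Fin n → ℝ) (hμ : eLpNorm μ s Measure.count ≤ 1) (f : Fin n → Y → ℝ)
    (hf : ∀ k, f k ∈ dualBall Y y₀) :
    eLpNorm (fun j => σ j * dN s μ f (S (x' j)) (S (x'' j))) p Measure.count ≤
      B * weakNorm x₀ r σ x' x'' := by
  have hz : ∀ j, ∃ z : lp (fun _ : ℕ => ℝ) (conjExp s), ‖z‖ ≤ 1 ∧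
      pair (conjExp s) μ f (S (x' j)) z - pair (conjExp s) μ f (S (x'' j)) z =
        dN s μ f (S (x' j)) (S (x'' j)) := by
    intro j
    obtain ⟨v, hv, hvs⟩ := duality hs (fun k => μ k * (f k (S (x' j)) - f k (S (x'' j))))
    obtain ⟨w, hw, hwk⟩ := lp_embed hF.out v
    refine ⟨w, hw.trans ?_, ?_⟩
    · rw [← ENNReal.toReal_one]; exact ENNReal.toReal_mono (by simp) hv
    · rw [pair_sub]
      simp only [hwk]
      exact hvs
  choose z hz1 hz2 using hz
  obtain ⟨c, hc, hcs⟩ := duality hp (fun j => σ j * dN s μ f (S (x' j)) (S (x'' j)))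
  have hlin : ∀ (y : Y) (t : ℝ) (w : lp (fun _ : ℕ => ℝ) (conjExp s)),
      pair (conjExp s) μ f y (t • w) = t * pair (conjExp s) μ f y w := by
    intro y t w
    simp only [pair, AddMonoidHom.coe_mk, ZeroHom.coe_mk, Finset.mul_sum]
    refine Finset.sum_congr rfl fun k _ => ?_
    simp [mul_assoc]
  set v : Fin m → lp (fun _ : ℕ => ℝ) (conjExp s) := fun j => (c j * σ j) • z j with hv
  have h1 := functional_le y₀ hs μ hμ f hf
    (∑ j, (Finsupp.single (S (x' j)) (v j) - Finsupp.single (S (x'' j)) (v j)))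
  have h2 := hB _ (mol_mem v x' x'')
  rw [molMap_sum] at h2
  have h3 := csNorm_le x₀ (conjExp p) r v x' x'' (fun j => (σ j)⁻¹)
    (fun j => inv_ne_zero (hσ j))
  have h4 : eLpNorm (fun j => (σ j)⁻¹ * ‖v j‖) (conjExp p) Measure.count ≤ 1 := by
    refine le_trans (eLp_mono _ fun j => ?_) hc
    rw [hv]
    simp only [norm_smul, norm_mul, Real.norm_eq_abs, abs_mul, abs_inv, abs_abs]
    have h5 : |σ j| ≠ 0 := abs_ne_zero.2 (hσ j)
    rw [abs_of_nonneg (norm_nonneg (z j))]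
    calc _ = |c j| * ‖z j‖ := by field_simp
      _ ≤ _ := mul_le_of_le_one_right (abs_nonneg _) (hz1 j)
  have h6 : Finsupp.liftAddHom (pair (conjExp s) μ f)
      (∑ j, (Finsupp.single (S (x' j)) (v j) - Finsupp.single (S (x'' j)) (v j))) =
      (eLpNorm (fun j => σ j * dN s μ f (S (x' j)) (S (x'' j))) p Measure.count).toReal := by
    rw [← hcs, map_sum]
    refine Finset.sum_congr rfl fun j _ => ?_
    simp only [map_sub, Finsupp.liftAddHom_apply_single, hv, hlin, ← mul_sub, hz2]
    ring
  rw [h6, enorm_toReal' (eLp_lt_top _ _).ne] at h1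
  refine h1.trans (h2.trans (mul_le_mul_right (h3.trans ?_) B))
  simp only [inv_inv]
  exact mul_le_of_le_one_left' h4

lemma mol_rep {X E : Type*} [NormedAddCommGroup E] (x₀ : X) (mo : X →₀ E)
    (h : mo ∈ molecules X E) : ∃ (k : ℕ) (v : Fin k → E) (x' x'' : Fin k → X),
      mo = ∑ j, (Finsupp.single (x' j) (v j) - Finsupp.single (x'' j) (v j)) := by
  classical
  let e := mo.support.equivFin
  refine ⟨mo.support.card, fun j => mo (e.symm j), fun j => (e.symm j : X), fun _ => x₀, ?_⟩
  rw [Finset.sum_sub_distrib]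
  have h1 : ∀ g : X → (X →₀ E), ∑ j, g (e.symm j) = ∑ x ∈ mo.support, g x := by
    intro g
    rw [Equiv.sum_comp e.symm (fun x => g (x : X)), Finset.sum_coe_sort mo.support g]
  rw [h1 (fun x => Finsupp.single x (mo x)), h1 (fun x => Finsupp.single x₀ (mo x)),
    ← Finsupp.single_finsetSum]
  have h2 : ∑ x ∈ mo.support, mo x = 0 := h
  rw [h2]
  simp only [Finsupp.single_zero, sub_zero]
  exact (Finsupp.sum_single mo).symm

lemma forward_rep {X Y : Type*} [MetricSpace X] [MetricSpace Y] (x₀ : X) (y₀ : Y)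
    {s p r : ℝ≥0∞} (hp : 1 ≤ p) (hps : p ≤ s)
    (S : X → Y) (C : ℝ≥0)
    (hC : ∀ (m : ℕ) (σ : Fin m → ℝ) (x' x'' : Fin m → X),
      mixedNorm y₀ s p σ (S ∘ x') (S ∘ x'') ≤ C * weakNorm x₀ r σ x' x'')
    (G : Type*) [NormedAddCommGroup G] {k : ℕ} (v : Fin k → G) (x' x'' : Fin k → X)
    (σ : Fin k → ℝ) (hσ : ∀ j, σ j ≠ 0) :
    csNorm y₀ (conjExp s) s
      (molMap S (∑ j, (Finsupp.single (x' j) (v j) - Finsupp.single (x'' j) (v j)))) ≤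
      C * (eLpNorm (fun j => σ j * ‖v j‖) (conjExp p) Measure.count *
        weakNorm x₀ r (fun j => (σ j)⁻¹) x' x'') := by
  rw [molMap_sum]
  set a := eLpNorm (fun j => σ j * ‖v j‖) (conjExp p) Measure.count with ha
  have h1 : ∀ τ : Fin k → ℝ, (∀ j, τ j ≠ 0) → csNorm y₀ (conjExp s) s
      (∑ j, (Finsupp.single (S (x' j)) (v j) - Finsupp.single (S (x'' j)) (v j))) ≤
      a * (eLpNorm τ (conjIdx p s) Measure.count *
        weakNorm y₀ s (fun j => (σ j)⁻¹ / τ j) (S ∘ x') (S ∘ x'')) := by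
    intro τ hτ
    refine (csNorm_le y₀ (conjExp s) s v _ _ (fun j => τ j * σ j)
      (fun j => mul_ne_zero (hτ j) (hσ j))).trans ?_
    have h2 := holder_mul (conj_holder hp hps) τ (fun j => σ j * ‖v j‖)
    have h3 : (fun j => (τ j * σ j)⁻¹) = fun j => (σ j)⁻¹ / τ j := by
      funext j; rw [mul_inv]; ring
    have h2' : eLpNorm (fun j => τ j * σ j * ‖v j‖) (conjExp s) Measure.count ≤
        eLpNorm τ (conjIdx p s) Measure.count * a := by
      simpa only [mul_assoc] using h2
    rw [h3, ← mul_assoc, mul_comm a]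
    exact mul_le_mul_left h2' _
  have h4 : csNorm y₀ (conjExp s) s
      (∑ j, (Finsupp.single (S (x' j)) (v j) - Finsupp.single (S (x'' j)) (v j))) ≤
      a * mixedNorm y₀ s p (fun j => (σ j)⁻¹) (S ∘ x') (S ∘ x'') := by
    rcases eq_or_ne a 0 with h0 | h0
    · have := h1 (fun _ => 1) (by simp)
      rw [h0, zero_mul] at this
      rw [h0, zero_mul]; exact this
    · have hat : a ≠ ⊤ := (eLp_lt_top _ _).ne
      unfold mixedNorm
      rw [ENNReal.mul_iInf_of_ne h0 hat]
      refine le_iInf fun τ => ?_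
      rw [ENNReal.mul_iInf_of_ne h0 hat]
      exact le_iInf fun hτ => h1 τ hτ
  refine h4.trans ((mul_le_mul_right (hC _ _ _ _) a).trans (le_of_eq ?_))
  ring

lemma forward {X Y : Type*} [MetricSpace X] [MetricSpace Y] (x₀ : X) (y₀ : Y)
    {s p r : ℝ≥0∞} (hp : 1 ≤ p) (hps : p ≤ s)
    (S : X → Y) (C : ℝ≥0)
    (hC : ∀ (m : ℕ) (σ : Fin m → ℝ) (x' x'' : Fin m → X),
      mixedNorm y₀ s p σ (S ∘ x') (S ∘ x'') ≤ C * weakNorm x₀ r σ x' x'')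
    (G : Type*) [NormedAddCommGroup G] (mo : X →₀ G) (hmo : mo ∈ molecules X G) :
    csNorm y₀ (conjExp s) s (molMap S mo) ≤ C * csNorm x₀ (conjExp p) r mo := by
  rcases eq_or_ne C 0 with h0 | h0
  · obtain ⟨k, v, x', x'', rfl⟩ := mol_rep x₀ mo hmo
    have := forward_rep x₀ y₀ hp hps S C hC G v x' x'' (fun _ => 1) (by simp)
    rw [h0] at this ⊢
    simp only [ENNReal.coe_zero, zero_mul] at this ⊢
    exact this
  have h0' : (C : ℝ≥0∞) ≠ 0 := by simpa using h0
  conv_rhs => unfold csNorm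
  simp only [ENNReal.mul_iInf_of_ne h0' ENNReal.coe_ne_top]
  refine le_iInf fun k => le_iInf fun v => le_iInf fun x' => le_iInf fun x'' => le_iInf fun σ =>
    le_iInf fun hσ => le_iInf fun hmo => ?_
  subst hmo
  exact forward_rep x₀ y₀ hp hps S C hC G v x' x'' σ hσ

lemma real_opt {m : ℕ} (K : Set (Fin m → ℝ)) (hK0 : ∀ a ∈ K, ∀ j, 0 ≤ a j)
    (hKb : Bornology.IsBounded K) (hKn : K.Nonempty) (σ : Fin m → ℝ) (hσ : ∀ j, σ j ≠ 0)
    {P Q : ℝ} (hP : 1 ≤ P) (hPQ : P < Q) (M0 : ℝ)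
    (hM : ∀ a ∈ convexHull ℝ K, ∑ j, |σ j| ^ P * a j ^ (P / Q) ≤ M0) (ε : ℝ) (hε : 0 < ε) :
    ∃ (τ : Fin m → ℝ) (M : ℝ), (∀ j, 0 < τ j) ∧ 0 ≤ M ∧ ∑ j, τ j ^ (1 / P - 1 / Q)⁻¹ = M ∧
      (∀ a ∈ K, ∑ j, (|σ j| / τ j) ^ Q * a j ≤ M) ∧
      M ≤ M0 + (∑ j, |σ j| ^ P) * ε ^ (P / Q) := by
  set θ := P / Q with hθ
  have hQ0 : 0 < Q := by linarith
  have hP0 : 0 < P := by linarith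
  have hθ0 : 0 < θ := by positivity
  have hθ1 : θ < 1 := (div_lt_one hQ0).2 hPQ
  set C := closure (convexHull ℝ K) with hC
  have hCc : IsCompact C := by
    rw [hC]
    exact Metric.isCompact_of_isClosed_isBounded isClosed_closure
      (Bornology.IsBounded.closure ((isBounded_convexHull).2 hKb))
  have hCconv : Convex ℝ C := (convex_convexHull ℝ K).closure
  have hKC : K ⊆ C := (subset_convexHull ℝ K).trans subset_closure
  have hCn : C.Nonempty := hKn.mono hKC
  have hC0 : ∀ a ∈ C, ∀ j, 0 ≤ a j := by
    have h1 : convexHull ℝ K ⊆ Set.Ici 0 :=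
      convexHull_min (fun a ha => fun j => hK0 a ha j) (convex_Ici 0)
    have h2 : C ⊆ Set.Ici 0 := closure_minimal h1 isClosed_Ici
    exact fun a ha j => h2 ha j
  have hCM : ∀ a ∈ C, ∑ j, |σ j| ^ P * a j ^ θ ≤ M0 := by
    have hcl : IsClosed {a : Fin m → ℝ | ∑ j, |σ j| ^ P * a j ^ θ ≤ M0} := by
      refine isClosed_le ?_ continuous_const
      refine continuous_finsetSum _ fun j _ => ?_
      exact continuous_const.mul ((continuous_apply j).rpow_const fun _ => Or.inr hθ0.le)
    exact fun a ha => closure_minimal hM hcl ha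
  let F : (Fin m → ℝ) → ℝ := fun a => ∑ j, |σ j| ^ P * (a j + ε) ^ θ
  have hF : Continuous F := by
    refine continuous_finsetSum _ fun j _ => ?_
    exact continuous_const.mul
      (((continuous_apply j).add continuous_const).rpow_const fun _ => Or.inr hθ0.le)
  obtain ⟨b, hb, hmax⟩ := hCc.exists_isMaxOn hCn hF.continuousOn
  have hu : ∀ j, 0 < b j + ε := fun j => by linarith [hC0 b hb j]
  have hsp : ∀ j, 0 < |σ j| := fun j => abs_pos.2 (hσ j)
  have hfo : ∀ a ∈ K, ∑ j, |σ j| ^ P * (b j + ε) ^ (θ - 1) * (a j - b j) ≤ 0 := by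
    intro a ha
    let g : ℝ → ℝ := fun l => ∑ j, |σ j| ^ P * (b j + ε + l * (a j - b j)) ^ θ
    have hg : HasDerivAt g
        (∑ j, |σ j| ^ P * ((a j - b j) * θ * (b j + ε) ^ (θ - 1))) 0 := by
      refine HasDerivAt.fun_sum fun j _ => HasDerivAt.const_mul _ ?_
      have h1 : HasDerivAt (fun l : ℝ => b j + ε + l * (a j - b j)) (a j - b j) 0 := by
        simpa using ((hasDerivAt_id (0 : ℝ)).mul_const (a j - b j)).const_add (b j + ε)
      have h2 := h1.rpow_const (p := θ) (Or.inl (by simpa using (hu j).ne'))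
      simpa using h2
    have hmx : IsMaxOn g (Set.Icc 0 1) 0 := by
      intro l hl
      have hmem : b + l • (a - b) ∈ C := by
        have := hCconv.add_smul_sub_mem hb (hKC ha) hl
        exact this
      have h3 := hmax hmem
      simp only [Set.mem_ofPred_eq] at h3 ⊢
      have e1 : g l = F (b + l • (a - b)) := by
        refine Finset.sum_congr rfl fun j _ => ?_
        simp only [Pi.add_apply, Pi.smul_apply, Pi.sub_apply, smul_eq_mul]
        congr 2; ring
      have e2 : g 0 = F b := by
        refine Finset.sum_congr rfl fun j _ => ?_
        simp
      rw [e1, e2]; exact h3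
    have h4 := hmx.localize.hasFDerivWithinAt_nonpos hg.hasFDerivAt.hasFDerivWithinAt
      (y := 1) (mem_posTangentConeAt_of_segment_subset (by
        rw [segment_eq_Icc (by norm_num)]; simp))
    simp only [ContinuousLinearMap.toSpanSingleton_apply, one_smul] at h4
    have h5 : ∑ j, |σ j| ^ P * ((a j - b j) * θ * (b j + ε) ^ (θ - 1)) =
        θ * ∑ j, |σ j| ^ P * (b j + ε) ^ (θ - 1) * (a j - b j) := by
      rw [Finset.mul_sum]
      refine Finset.sum_congr rfl fun j _ => by ring
    rw [h5] at h4
    exact nonpos_of_mul_nonpos_right h4 hθ0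
  refine ⟨fun j => |σ j| ^ (1 - θ) * (b j + ε) ^ ((1 - θ) / Q), F b, ?_, ?_, ?_, ?_, ?_⟩
  · intro j
    exact mul_pos (Real.rpow_pos_of_pos (hsp j) _) (Real.rpow_pos_of_pos (hu j) _)
  · exact Finset.sum_nonneg fun j _ => mul_nonneg (Real.rpow_nonneg (hsp j).le _)
      (Real.rpow_nonneg (hu j).le _)
  · refine Finset.sum_congr rfl fun j _ => ?_
    have hne : 1 / P - 1 / Q ≠ 0 := by
      have : 1 / Q < 1 / P := one_div_lt_one_div_of_lt hP0 hPQ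
      linarith
    have hne2 : Q - P ≠ 0 := by linarith
    rw [Real.mul_rpow (Real.rpow_nonneg (hsp j).le _) (Real.rpow_nonneg (hu j).le _),
      ← Real.rpow_mul (hsp j).le, ← Real.rpow_mul (hu j).le]
    have e : (1 / P - 1 / Q)⁻¹ = P / (1 - θ) := by
      rw [hθ]; field_simp
    have h1θ : 1 - θ ≠ 0 := by linarith
    rw [e]
    congr 2
    · field_simp
    · rw [hθ] at h1θ ⊢; field_simp
  · intro a ha
    have h1 := hfo a ha
    have h2 : ∀ j, (|σ j| / (|σ j| ^ (1 - θ) * (b j + ε) ^ ((1 - θ) / Q))) ^ Q =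
        |σ j| ^ P * (b j + ε) ^ (θ - 1) := by
      intro j
      have e1 : |σ j| / (|σ j| ^ (1 - θ) * (b j + ε) ^ ((1 - θ) / Q)) =
          |σ j| ^ θ * (b j + ε) ^ ((θ - 1) / Q) := by
        rw [div_eq_iff (by have := hsp j; have := hu j; positivity)]
        calc |σ j| = |σ j| ^ (θ + (1 - θ)) * (b j + ε) ^ ((θ - 1) / Q + (1 - θ) / Q) := by
              rw [show θ + (1 - θ) = 1 by ring, show (θ - 1) / Q + (1 - θ) / Q = 0 by ring]
              simp
          _ = _ := by
              rw [Real.rpow_add (hsp j), Real.rpow_add (hu j)]; ring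
      rw [e1, Real.mul_rpow (Real.rpow_nonneg (hsp j).le _) (Real.rpow_nonneg (hu j).le _),
        ← Real.rpow_mul (hsp j).le, ← Real.rpow_mul (hu j).le]
      congr 2
      · rw [hθ]; field_simp
      · field_simp
    simp only [h2]
    have h3 : ∑ j, |σ j| ^ P * (b j + ε) ^ (θ - 1) * a j ≤
        ∑ j, |σ j| ^ P * (b j + ε) ^ (θ - 1) * b j := by
      rw [← sub_nonpos, ← Finset.sum_sub_distrib]
      simpa only [mul_sub] using h1
    refine h3.trans (Finset.sum_le_sum fun j _ => ?_)
    rw [mul_assoc]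
    refine mul_le_mul_of_nonneg_left ?_ (Real.rpow_nonneg (hsp j).le _)
    calc (b j + ε) ^ (θ - 1) * b j ≤ (b j + ε) ^ (θ - 1) * (b j + ε) :=
          mul_le_mul_of_nonneg_left (by linarith) (Real.rpow_nonneg (hu j).le _)
      _ = (b j + ε) ^ θ := by
          rw [Real.rpow_sub_one (hu j).ne']; have := (hu j).ne'; field_simp
  · rw [Finset.sum_mul]
    calc F b ≤ ∑ j, (|σ j| ^ P * b j ^ θ + |σ j| ^ P * ε ^ θ) := by
          refine Finset.sum_le_sum fun j _ => ?_
          rw [← mul_add]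
          refine mul_le_mul_of_nonneg_left ?_ (Real.rpow_nonneg (hsp j).le _)
          exact Real.rpow_add_le_add_rpow (hC0 b hb j) hε.le hθ0.le hθ1.le
      _ = ∑ j, |σ j| ^ P * b j ^ θ + ∑ j, |σ j| ^ P * ε ^ θ := Finset.sum_add_distrib
      _ ≤ _ := by linarith [hCM b hb]

lemma eLp_real {n : ℕ} (f : Fin n → ℝ) {p : ℝ≥0∞} (h0 : p ≠ 0) (ht : p ≠ ⊤) :
    eLpNorm f p Measure.count = ENNReal.ofReal ((∑ j, |f j| ^ p.toReal) ^ (1 / p.toReal)) := by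
  have hpos := ENNReal.toReal_pos h0 ht
  rw [eLp_fin f h0 ht, ← ENNReal.ofReal_rpow_of_nonneg
    (Finset.sum_nonneg fun j _ => Real.rpow_nonneg (abs_nonneg _) _) (by positivity),
    ENNReal.ofReal_sum_of_nonneg fun j _ => Real.rpow_nonneg (abs_nonneg _) _]
  congr 1
  refine Finset.sum_congr rfl fun j _ => ?_
  rw [← ENNReal.ofReal_rpow_of_nonneg (abs_nonneg _) hpos.le, ← Real.norm_eq_abs, ofReal_norm]

lemma eLp_single {g : Fin 1 → ℝ} {s : ℝ≥0∞} (h0 : s ≠ 0) :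
    eLpNorm g s Measure.count = ‖g 0‖ₑ := by
  rcases eq_or_ne s ⊤ with rfl | ht
  · rw [eLp_top]; simp
  · rw [eLp_fin _ h0 ht]
    simp only [Finset.univ_unique, Fin.default_eq_zero, Finset.sum_singleton, one_div]
    rw [ENNReal.rpow_rpow_inv (ENNReal.toReal_pos h0 ht).ne']

lemma le_of_eps {M D c : ℝ≥0∞} (hc : c ≠ ⊤)
    (h : ∀ ε : ℝ, 0 < ε → M ≤ D + ENNReal.ofReal ε * c) : M ≤ D := by
  have ht : Filter.Tendsto (fun ε : ℝ => D + ENNReal.ofReal ε * c) (nhdsWithin 0 (Set.Ioi 0))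
      (nhds (D + ENNReal.ofReal 0 * c)) := by
    refine Filter.Tendsto.mono_left ?_ nhdsWithin_le_nhds
    refine Filter.Tendsto.const_add _ ?_
    exact ENNReal.Tendsto.mul_const (ENNReal.continuous_ofReal.tendsto 0) (Or.inr hc)
  rw [ENNReal.ofReal_zero, zero_mul, add_zero] at ht
  refine ge_of_tendsto ht ?_
  filter_upwards [self_mem_nhdsWithin] with ε hε using h ε hε

lemma mixed_le_of {Y : Type*} [MetricSpace Y] (y₀ : Y) (s p : ℝ≥0∞)
    {m : ℕ} (σ : Fin m → ℝ) (y' y'' : Fin m → Y) (τ : Fin m → ℝ) (hτ : ∀ j, τ j ≠ 0) :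
    mixedNorm y₀ s p σ y' y'' ≤ eLpNorm τ (conjIdx p s) Measure.count *
      weakNorm y₀ s (fun j => σ j / τ j) y' y'' :=
  iInf₂_le_of_le τ hτ le_rfl

lemma mixed_le_eq {Y : Type*} [MetricSpace Y] (y₀ : Y) {s : ℝ≥0∞} (hs : 1 ≤ s)
    {m : ℕ} (σ : Fin m → ℝ) (y' y'' : Fin m → Y) (D : ℝ≥0∞)
    (hD : ∀ (n : ℕ) (μ : Fin n → ℝ) (f : Fin n → Y → ℝ), eLpNorm μ s Measure.count ≤ 1 →
      (∀ k, f k ∈ dualBall Y y₀) →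
      eLpNorm (fun j => σ j * dN s μ f (y' j) (y'' j)) s Measure.count ≤ D) :
    mixedNorm y₀ s s σ y' y'' ≤ D := by
  have h0 : s ≠ 0 := (lt_of_lt_of_le one_pos hs).ne'
  refine (mixed_le_of y₀ s s σ y' y'' (fun _ => 1) (by simp)).trans ?_
  have hc : conjIdx s s = ⊤ := by simp [conjIdx]
  rw [hc, eLp_top]
  have h1 : ⨆ _ : Fin m, ‖(1 : ℝ)‖ₑ ≤ 1 := iSup_le fun _ => by simp
  refine (mul_le_of_le_one_left' h1).trans ?_
  simp only [div_one]
  refine iSup₂_le fun f hf => ?_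
  refine le_trans (eLp_mono _ fun j => ?_) (hD 1 (fun _ => 1) (fun _ => f) ?_ (fun _ => hf))
  · rw [abs_mul, abs_mul]
    refine mul_le_mul_of_nonneg_left (le_of_eq ?_) (abs_nonneg _)
    rw [dN, eLp_single h0]
    simp
  · rw [eLp_single h0]; simp

lemma mixed_le_top {Y : Type*} [MetricSpace Y] (y₀ : Y) {p : ℝ≥0∞} (hp : 1 ≤ p)
    {m : ℕ} (σ : Fin m → ℝ) (hσ : ∀ j, σ j ≠ 0) (y' y'' : Fin m → Y) (D : ℝ≥0∞)
    (hD : ∀ (n : ℕ) (μ : Fin n → ℝ) (f : Fin n → Y → ℝ), eLpNorm μ ⊤ Measure.count ≤ 1 →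
      (∀ k, f k ∈ dualBall Y y₀) →
      eLpNorm (fun j => σ j * dN ⊤ μ f (y' j) (y'' j)) p Measure.count ≤ D) :
    mixedNorm y₀ ⊤ p σ y' y'' ≤ D := by
  have hc : conjIdx p ⊤ = p := by simp [conjIdx]
  have h1 : eLpNorm (fun j => σ j * dist (y' j) (y'' j)) p Measure.count ≤ D := by
    refine le_trans (eLp_mono _ fun j => ?_)
      (hD m (fun _ => 1) (fun k y => dist y (y'' k) - dist y₀ (y'' k)) ?_ ?_)
    · rw [abs_mul, abs_mul]
      refine mul_le_mul_of_nonneg_left ?_ (abs_nonneg _)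
      rw [← Real.norm_eq_abs, ← Real.norm_eq_abs, ← enorm_le_iff_norm_le, enorm_dN]
      refine le_trans (le_of_eq ?_) (enorm_le_eLpNorm_count _ j (by simp))
      simp
    · rw [eLp_top]; exact iSup_le fun _ => by simp
    · intro k
      refine ⟨?_, by simp⟩
      refine LipschitzWith.of_dist_le_mul fun a b => ?_
      rw [Real.dist_eq]
      have := abs_dist_sub_le a b (y'' k)
      simpa using this
  refine le_of_eps (c := eLpNorm σ p Measure.count) (eLp_lt_top _ _).ne fun ε hε => ?_
  have hd : ∀ j, 0 < dist (y' j) (y'' j) + ε := fun j => by positivity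
  refine (mixed_le_of y₀ ⊤ p σ y' y'' (fun j => σ j * (dist (y' j) (y'' j) + ε))
    (fun j => mul_ne_zero (hσ j) (hd j).ne')).trans ?_
  have hw : weakNorm y₀ ⊤ (fun j => σ j / (σ j * (dist (y' j) (y'' j) + ε))) y' y'' ≤ 1 := by
    refine iSup₂_le fun f hf => ?_
    rw [eLp_top]
    refine iSup_le fun j => ?_
    rw [← enorm_one (G := ℝ), enorm_le_iff_norm_le, Real.norm_eq_abs, abs_mul]
    have h2 : |f (y' j) - f (y'' j)| ≤ dist (y' j) (y'' j) := by
      have := hf.1.dist_le_mul (y' j) (y'' j)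
      simpa [Real.dist_eq] using this
    have h3 : σ j / (σ j * (dist (y' j) (y'' j) + ε)) = (dist (y' j) (y'' j) + ε)⁻¹ := by
      have := hσ j; have := (hd j).ne'; field_simp
    beta_reduce
    rw [h3, abs_inv, abs_of_pos (hd j)]
    rw [inv_mul_le_iff₀ (hd j)]
    simp; linarith
  rw [hc]
  refine (mul_le_of_le_one_right' hw).trans ?_
  have h4 : (fun j => σ j * (dist (y' j) (y'' j) + ε)) =
      (fun j => σ j * dist (y' j) (y'' j)) + ε • σ := by
    funext j; simp; ring
  rw [h4]
  refine (eLpNorm_add_le (by fun_prop) (by fun_prop) hp).trans ?_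
  refine add_le_add h1 (le_of_eq ?_)
  rw [eLpNorm_const_smul, Real.enorm_of_nonneg hε.le]

lemma mixed_le_mid {Y : Type*} [MetricSpace Y] (y₀ : Y) {s p : ℝ≥0∞} (hp : 1 ≤ p)
    (hps : p < s) (hst : s ≠ ⊤)
    {m : ℕ} (σ : Fin m → ℝ) (hσ : ∀ j, σ j ≠ 0) (y' y'' : Fin m → Y) (D : ℝ≥0∞)
    (hD : ∀ (n : ℕ) (μ : Fin n → ℝ) (f : Fin n → Y → ℝ), eLpNorm μ s Measure.count ≤ 1 →
      (∀ k, f k ∈ dualBall Y y₀) →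
      eLpNorm (fun j => σ j * dN s μ f (y' j) (y'' j)) p Measure.count ≤ D) :
    mixedNorm y₀ s p σ y' y'' ≤ D := by
  rcases eq_or_ne D ⊤ with rfl | hDt
  · exact le_top
  have hp0 : p ≠ 0 := (lt_of_lt_of_le one_pos hp).ne'
  have hpt : p ≠ ⊤ := (hps.trans_le le_top).ne
  have hs0 : s ≠ 0 := (lt_of_lt_of_le one_pos (hp.trans hps.le)).ne'
  set P := p.toReal with hPdef
  set Q := s.toReal with hQdef
  have hP1 : 1 ≤ P := by
    rw [← ENNReal.toReal_one]; exact ENNReal.toReal_mono hpt hp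
  have hPQ : P < Q := (ENNReal.toReal_lt_toReal hpt hst).2 hps
  have hP0 : 0 < P := by linarith
  have hQ0 : 0 < Q := by linarith
  have hlt : 1 / Q < 1 / P := one_div_lt_one_div_of_lt hP0 hPQ
  let K : Set (Fin m → ℝ) :=
    (fun (f : Y → ℝ) j => |f (y' j) - f (y'' j)| ^ Q) '' dualBall Y y₀
  have hK0 : ∀ a ∈ K, ∀ j, 0 ≤ a j := by
    rintro _ ⟨f, hf, rfl⟩ j
    exact Real.rpow_nonneg (abs_nonneg _) _
  have hKn : K.Nonempty := ⟨_, fun _ => 0, ⟨LipschitzWith.const' 0, rfl⟩, rfl⟩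
  have hKb : Bornology.IsBounded K := by
    refine (Metric.isBounded_Icc (0 : Fin m → ℝ) (fun j => dist (y' j) (y'' j) ^ Q)).subset ?_
    rintro _ ⟨f, hf, rfl⟩
    refine ⟨fun j => Real.rpow_nonneg (abs_nonneg _) _, fun j => ?_⟩
    refine Real.rpow_le_rpow (abs_nonneg _) ?_ hQ0.le
    have := hf.1.dist_le_mul (y' j) (y'' j)
    simpa [Real.dist_eq] using this
  have hM : ∀ a ∈ convexHull ℝ K, ∑ j, |σ j| ^ P * a j ^ (P / Q) ≤ D.toReal ^ P := by
    intro a ha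
    rw [mem_convexHull_iff_exists_fintype] at ha
    obtain ⟨ι, _, w, z, hw0, hw1, hz, hsum⟩ := ha
    choose f hf hfz using hz
    let e := (Fintype.equivFin ι).symm
    have h1 := hD (Fintype.card ι) (fun k => w (e k) ^ (1 / Q)) (fun k => f (e k)) ?_
      (fun k => hf _)
    · have hdN : ∀ j, dN s (fun k => w (e k) ^ (1 / Q)) (fun k => f (e k)) (y' j) (y'' j) =
          a j ^ (1 / Q) := by
        intro j
        rw [dN, eLp_real _ hs0 hst, ENNReal.toReal_ofReal (by positivity)]
        congr 1
        rw [← hsum, Finset.sum_apply, ← Equiv.sum_comp e]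
        refine Finset.sum_congr rfl fun k _ => ?_
        rw [← hfz, abs_mul, Real.mul_rpow (abs_nonneg _) (abs_nonneg _),
          abs_of_nonneg (Real.rpow_nonneg (hw0 _) _), ← Real.rpow_mul (hw0 _)]
        rw [one_div_mul_cancel hQ0.ne']
        simp [Q]
      have ha0 : ∀ j, 0 ≤ a j := by
        intro j
        rw [← hsum, Finset.sum_apply]
        refine Finset.sum_nonneg fun i _ => mul_nonneg (hw0 i) ?_
        rw [← hfz]; exact Real.rpow_nonneg (abs_nonneg _) _
      simp only [hdN] at h1
      rw [eLp_real _ hp0 hpt] at h1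
      have h2 := (ENNReal.ofReal_le_iff_le_toReal hDt).1 h1
      rw [← hPdef, one_div P, Real.rpow_inv_le_iff_of_pos (by positivity) ENNReal.toReal_nonneg hP0] at h2
      refine le_trans (le_of_eq (Finset.sum_congr rfl fun j _ => ?_)) h2
      rw [abs_mul, Real.mul_rpow (abs_nonneg _) (abs_nonneg _),
        abs_of_nonneg (Real.rpow_nonneg (ha0 j) _), ← Real.rpow_mul (ha0 j)]
      congr 2; ring
    · rw [eLp_real _ hs0 hst, ← ENNReal.ofReal_one]
      refine ENNReal.ofReal_le_ofReal (Real.rpow_le_one (by positivity) ?_ (by positivity))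
      refine le_trans (le_of_eq ?_) hw1.le
      rw [← Equiv.sum_comp e]
      refine (Finset.sum_congr rfl fun k _ => ?_)
      rw [abs_of_nonneg (Real.rpow_nonneg (hw0 _) _), ← Real.rpow_mul (hw0 _),
        one_div_mul_cancel hQ0.ne', Real.rpow_one]
  have hti : (conjIdx p s).toReal = (1 / P - 1 / Q)⁻¹ := by
    unfold conjIdx
    rw [ENNReal.toReal_inv, ENNReal.toReal_sub_of_le (by simpa using hps.le) (by simpa using hp0)]
    simp [P, Q]
  have ht0 : conjIdx p s ≠ 0 := by
    simp [conjIdx, ENNReal.sub_eq_top_iff, hp0]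
  have htt : conjIdx p s ≠ ⊤ := by
    simp [conjIdx, tsub_eq_zero_iff_le, hps]
  set c := ∑ j, |σ j| ^ P with hc
  have hmain : ∀ ε : ℝ, 0 < ε → mixedNorm y₀ s p σ y' y'' ≤
      ENNReal.ofReal ((D.toReal ^ P + c * ε ^ (P / Q)) ^ (1 / P)) := by
    intro ε hε
    obtain ⟨τ, M, hτ, hM0, hτM, hKM, hMle⟩ :=
      real_opt K hK0 hKb hKn σ hσ hP1 hPQ (D.toReal ^ P) hM ε hε
    refine (mixed_le_of y₀ s p σ y' y'' τ (fun j => (hτ j).ne')).trans ?_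
    have h1 : eLpNorm τ (conjIdx p s) Measure.count = ENNReal.ofReal (M ^ (1 / P - 1 / Q)) := by
      rw [eLp_real _ ht0 htt, hti, one_div (_⁻¹), inv_inv]
      congr 2
      rw [← hτM]
      exact Finset.sum_congr rfl fun j _ => by rw [abs_of_pos (hτ j)]
    have h2 : weakNorm y₀ s (fun j => σ j / τ j) y' y'' ≤ ENNReal.ofReal (M ^ (1 / Q)) := by
      refine iSup₂_le fun f hf => ?_
      rw [eLp_real _ hs0 hst]
      refine ENNReal.ofReal_le_ofReal (Real.rpow_le_rpow (by positivity) ?_ (by positivity))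
      refine le_trans (le_of_eq (Finset.sum_congr rfl fun j _ => ?_)) (hKM _ ⟨f, hf, rfl⟩)
      rw [abs_mul, Real.mul_rpow (abs_nonneg _) (abs_nonneg _), abs_div, abs_of_pos (hτ j)]
    rw [h1]
    refine (mul_le_mul_right h2 _).trans ?_
    rw [← ENNReal.ofReal_mul (by positivity)]
    refine ENNReal.ofReal_le_ofReal ?_
    rw [← Real.rpow_add_of_nonneg hM0 (by linarith) (by positivity)]
    rw [sub_add_cancel]
    exact Real.rpow_le_rpow hM0 hMle (by positivity)
  have hlim : Filter.Tendsto
      (fun ε : ℝ => ENNReal.ofReal ((D.toReal ^ P + c * ε ^ (P / Q)) ^ (1 / P)))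
      (nhdsWithin 0 (Set.Ioi 0))
      (nhds (ENNReal.ofReal ((D.toReal ^ P + c * (0 : ℝ) ^ (P / Q)) ^ (1 / P)))) := by
    refine Filter.Tendsto.mono_left ?_ nhdsWithin_le_nhds
    refine Continuous.tendsto (ENNReal.continuous_ofReal.comp ?_) 0
    refine Continuous.rpow_const ?_ fun _ => Or.inr (by positivity)
    refine continuous_const.add (continuous_const.mul ?_)
    exact continuous_id.rpow_const fun _ => Or.inr (by positivity)
  have hval : ENNReal.ofReal ((D.toReal ^ P + c * (0 : ℝ) ^ (P / Q)) ^ (1 / P)) = D := by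
    rw [Real.zero_rpow (by positivity), mul_zero, add_zero, one_div,
      Real.rpow_rpow_inv ENNReal.toReal_nonneg hP0.ne', ENNReal.ofReal_toReal hDt]
  rw [hval] at hlim
  refine ge_of_tendsto hlim ?_
  filter_upwards [self_mem_nhdsWithin] with ε hε using hmain ε hε

lemma mixed_le {Y : Type*} [MetricSpace Y] (y₀ : Y) {s p : ℝ≥0∞} (hp : 1 ≤ p)
    (hps : p ≤ s) {m : ℕ} (σ : Fin m → ℝ) (hσ : ∀ j, σ j ≠ 0) (y' y'' : Fin m → Y) (D : ℝ≥0∞)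
    (hD : ∀ (n : ℕ) (μ : Fin n → ℝ) (f : Fin n → Y → ℝ), eLpNorm μ s Measure.count ≤ 1 →
      (∀ k, f k ∈ dualBall Y y₀) →
      eLpNorm (fun j => σ j * dN s μ f (y' j) (y'' j)) p Measure.count ≤ D) :
    mixedNorm y₀ s p σ y' y'' ≤ D := by
  rcases eq_or_lt_of_le hps with rfl | hlt
  · exact mixed_le_eq y₀ hp σ y' y'' D hD
  · rcases eq_or_ne s ⊤ with rfl | hst
    · exact mixed_le_top y₀ hp σ hσ y' y'' D hD
    · exact mixed_le_mid y₀ hp hlt hst σ hσ y' y'' D hD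

lemma mixed_mono {Y : Type*} [MetricSpace Y] (y₀ : Y) (s p : ℝ≥0∞) {m : ℕ}
    (σ σ' : Fin m → ℝ) (h : ∀ j, |σ j| ≤ |σ' j|) (y' y'' : Fin m → Y) :
    mixedNorm y₀ s p σ y' y'' ≤ mixedNorm y₀ s p σ' y' y'' := by
  refine iInf₂_mono fun τ _ => mul_le_mul_right (iSup₂_mono fun f _ => eLp_mono _ fun j => ?_) _
  rw [abs_mul, abs_mul, abs_div, abs_div]
  exact mul_le_mul_of_nonneg_right (div_le_div_of_nonneg_right (h j) (abs_nonneg _)) (abs_nonneg _)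

lemma weak_one {X : Type*} [MetricSpace X] (x₀ : X) (r : ℝ≥0∞) {m : ℕ} (x' x'' : Fin m → X) :
    weakNorm x₀ r (fun _ => 1) x' x'' ≠ ⊤ := by
  refine ne_top_of_le_ne_top
    (eLp_lt_top (fun j => dist (x' j) (x'' j)) r).ne (iSup₂_le fun f hf => eLp_mono _ fun j => ?_)
  have := hf.1.dist_le_mul (x' j) (x'' j)
  rw [abs_of_nonneg (dist_nonneg : 0 ≤ dist (x' j) (x'' j))]
  simpa [Real.dist_eq] using this

lemma weak_perturb {X : Type*} [MetricSpace X] (x₀ : X) {r : ℝ≥0∞} (hr : 1 ≤ r) {m : ℕ}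
    (x' x'' : Fin m → X) (σ σ' : Fin m → ℝ) {ε : ℝ} (hε : 0 < ε)
    (h : ∀ j, |σ' j| ≤ |σ j| + ε) :
    weakNorm x₀ r σ' x' x'' ≤ weakNorm x₀ r σ x' x'' +
      ENNReal.ofReal ε * weakNorm x₀ r (fun _ => 1) x' x'' := by
  refine iSup₂_le fun f hf => ?_
  have h1 : eLpNorm (fun j => σ' j * (f (x' j) - f (x'' j))) r Measure.count ≤
      eLpNorm ((fun j => |σ j * (f (x' j) - f (x'' j))|) +
        ε • (fun j => |1 * (f (x' j) - f (x'' j))|)) r Measure.count := by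
    refine eLp_mono _ fun j => ?_
    simp only [Pi.add_apply, Pi.smul_apply, smul_eq_mul, one_mul]
    rw [abs_of_nonneg (a := |σ j * (f (x' j) - f (x'' j))| + _) (by positivity), abs_mul, abs_mul,
      ← add_mul]
    exact mul_le_mul_of_nonneg_right (h j) (abs_nonneg _)
  refine h1.trans ((eLpNorm_add_le (by fun_prop) (by fun_prop) hr).trans ?_)
  rw [eLpNorm_const_smul, Real.enorm_of_nonneg hε.le]
  refine add_le_add ?_ (mul_le_mul_right ?_ _)
  · exact (eLp_mono _ fun j => by rw [abs_abs]).trans (le_weakNorm r σ x' x'' hf)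
  · exact (eLp_mono _ fun j => by rw [abs_abs]).trans (le_weakNorm r (fun _ => 1) x' x'' hf)

lemma backward {X Y : Type*} [MetricSpace X] [MetricSpace Y] (x₀ : X) (y₀ : Y)
    {s p r : ℝ≥0∞} (hs : 1 ≤ s) (hp : 1 ≤ p) (hps : p ≤ s) (hr : 1 ≤ r)
    [hF : Fact (1 ≤ conjExp s)]
    (S : X → Y) (B : ℝ≥0∞) (hBt : B ≠ ⊤)
    (hB : ∀ mo : X →₀ lp (fun _ : ℕ => ℝ) (conjExp s), mo ∈ molecules X _ →
      csNorm y₀ (conjExp s) s (molMap S mo) ≤ B * csNorm x₀ (conjExp p) r mo)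
    (m : ℕ) (σ : Fin m → ℝ) (x' x'' : Fin m → X) :
    mixedNorm y₀ s p σ (S ∘ x') (S ∘ x'') ≤ B * weakNorm x₀ r σ x' x'' := by
  refine le_of_eps (c := B * weakNorm x₀ r (fun _ => 1) x' x'')
    (ENNReal.mul_ne_top hBt (weak_one _ _ _ _)) fun ε hε => ?_
  let σ' : Fin m → ℝ := fun j => if σ j = 0 then ε else σ j
  have hσ' : ∀ j, σ' j ≠ 0 := by
    intro j
    by_cases h : σ j = 0
    · simp [σ', h, hε.ne']
    · simp [σ', h]
  have h1 : ∀ j, |σ j| ≤ |σ' j| := by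
    intro j
    by_cases h : σ j = 0 <;> simp [σ', h]
  have h2 : ∀ j, |σ' j| ≤ |σ j| + ε := by
    intro j
    by_cases h : σ j = 0
    · simp [σ', h, abs_of_pos hε]
    · simp [σ', h, hε.le]
  refine (mixed_mono y₀ s p σ σ' h1 _ _).trans ?_
  refine (mixed_le y₀ hp hps σ' hσ' (S ∘ x') (S ∘ x'') (B * weakNorm x₀ r σ' x' x'')
    fun n μ f hμ hf => key x₀ y₀ hs hp S B hB σ' hσ' x' x'' μ hμ f hf).trans ?_
  refine (mul_le_mul_right (weak_perturb x₀ hr x' x'' σ σ' hε h2) B).trans (le_of_eq ?_)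
  ring


/-- characterization of Lipschitz `(m^L(s;p),r)`-summing maps via boundedness
of the induced operators between Chevet–Saphar spaces of molecules. -/
theorem stmt11 {X Y : Type*} [MetricSpace X] [MetricSpace Y] (x₀ : X) (y₀ : Y)
    (s p r : ℝ≥0∞) (hs : 1 ≤ s) (hp : 1 ≤ p) (hps : p ≤ s) (hr : 1 ≤ r) (hrp : r ≤ p)
    [Fact (1 ≤ conjExp s)]
    (S : X → Y) (K : ℝ≥0) (hS : LipschitzWith K S) :
    (LipMixedP x₀ y₀ s p r S ↔
      ∀ (G : Type) [NormedAddCommGroup G] [NormedSpace ℝ G] [CompleteSpace G],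
        molBounded G x₀ y₀ (conjExp p) r (conjExp s) s S) ∧
    (LipMixedP x₀ y₀ s p r S ↔
      molBounded (lp (fun _ : ℕ => ℝ) (conjExp s)) x₀ y₀ (conjExp p) r (conjExp s) s S) ∧
    (LipMixedP x₀ y₀ s p r S →
      lipMixedPNorm x₀ y₀ s p r S =
        molOpNorm (lp (fun _ : ℕ => ℝ) (conjExp s)) x₀ y₀ (conjExp p) r (conjExp s) s S ∧
      ∀ (G : Type) [NormedAddCommGroup G] [NormedSpace ℝ G] [CompleteSpace G],
        molOpNorm G x₀ y₀ (conjExp p) r (conjExp s) s S ≤ lipMixedPNorm x₀ y₀ s p r S) := by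

  have hfw : ∀ (G : Type) [NormedAddCommGroup G], LipMixedP x₀ y₀ s p r S →
      molBounded G x₀ y₀ (conjExp p) r (conjExp s) s S := by
    rintro G _ ⟨C, hC⟩
    exact ⟨C, fun mo hmo => forward x₀ y₀ hp hps S C hC G mo hmo⟩
  have hbw : molBounded (lp (fun _ : ℕ => ℝ) (conjExp s)) x₀ y₀ (conjExp p) r (conjExp s) s S →
      LipMixedP x₀ y₀ s p r S := by
    rintro ⟨B, hB⟩
    exact ⟨B, backward x₀ y₀ hs hp hps hr S B ENNReal.coe_ne_top hB⟩
  have hle : ∀ (G : Type) [NormedAddCommGroup G],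
      molOpNorm G x₀ y₀ (conjExp p) r (conjExp s) s S ≤ lipMixedPNorm x₀ y₀ s p r S := by
    intro G _
    refine le_sInf fun C hC => ?_
    rcases eq_or_ne C ⊤ with rfl | hCt
    · exact le_top
    lift C to ℝ≥0 using hCt
    exact sInf_le fun mo hmo => forward x₀ y₀ hp hps S C hC G mo hmo
  refine ⟨⟨fun h G _ _ _ => hfw G h, fun h => hbw (h _)⟩, ⟨fun h => hfw _ h, hbw⟩, fun _ =>
    ⟨le_antisymm ?_ (hle _), fun G _ _ _ => hle G⟩⟩
  refine le_sInf fun B hB => ?_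
  rcases eq_or_ne B ⊤ with rfl | hBt
  · exact le_top
  exact sInf_le (backward x₀ y₀ hs hp hps hr S B hBt hB)
end
end

section
/- Let X and Y be pointed metric spaces, 0 < θ < 1, 0 < p ≤ s, s₀, s₁ ≤ ∞, 0 < r ≤ p, and define s by 1/s = (1−θ)/s₀ + θ/s₁. Then for every Lipschitz map S : X → Y that is both Lipschitz (m^L(s₀;p),r)-summing and Lipschitz (m^L(s₁;p),r)-summing, S is Lipschitz (m^L(s;p),r)-summing and π^L_{(m^L(s;p),r)}(S) ≤ π^L_{(m^L(s₀;p),r)}(S)^{1−θ} · π^L_{(m^L(s₁;p),r)}(S)^{θ}. -/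
open MeasureTheory ENNReal NNReal

noncomputable section

lemma aux_holder {m : ℕ} (θ : ℝ) (hθ0 : 0 < θ) (hθ1 : θ < 1) (p p₀ p₁ : ℝ≥0∞)
    (h : p⁻¹ = ENNReal.ofReal (1 - θ) * p₀⁻¹ + ENNReal.ofReal θ * p₁⁻¹)
    (u f g : Fin m → ℝ) (hu : ∀ j, |u j| = |f j| ^ (1 - θ) * |g j| ^ θ) :
    eLpNorm u p Measure.count ≤
      eLpNorm f p₀ Measure.count ^ (1 - θ) * eLpNorm g p₁ Measure.count ^ θ := by
  have h1 : 0 < 1 - θ := by linarith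
  have e1 : eLpNorm f p₀ Measure.count ^ (1 - θ)
      = eLpNorm (fun j => ‖f j‖ ^ (1 - θ)) (p₀ / ENNReal.ofReal (1 - θ)) Measure.count := by
    rw [eLpNorm_norm_rpow f h1, ENNReal.div_mul_cancel (by simpa using hθ1) (by simp)]
  have e2 : eLpNorm g p₁ Measure.count ^ θ
      = eLpNorm (fun j => ‖g j‖ ^ θ) (p₁ / ENNReal.ofReal θ) Measure.count := by
    rw [eLpNorm_norm_rpow g hθ0, ENNReal.div_mul_cancel (by simpa using hθ0) (by simp)]
  have e3 : eLpNorm u p Measure.count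
      = eLpNorm ((fun j => ‖f j‖ ^ (1 - θ)) • (fun j => ‖g j‖ ^ θ)) p Measure.count := by
    apply eLpNorm_congr_norm_ae
    refine Filter.Eventually.of_forall fun j => ?_
    simp only [Pi.smul_apply', smul_eq_mul, Real.norm_eq_abs, hu j]
    exact (abs_of_nonneg (a := |f j| ^ (1 - θ) * |g j| ^ θ) (by positivity)).symm
  have : ENNReal.HolderTriple (p₀ / ENNReal.ofReal (1 - θ)) (p₁ / ENNReal.ofReal θ) p := by
    constructor
    rw [h, ENNReal.inv_div (by simp) (by simp [hθ1]), ENNReal.inv_div (by simp) (by simp [hθ0])]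
    simp [div_eq_mul_inv]
  rw [e1, e2, e3]
  exact eLpNorm_smul_le_mul_eLpNorm (.of_discrete) (.of_discrete)

lemma aux_conj (θ : ℝ) (hθ0 : 0 < θ) (hθ1 : θ < 1) (s s₀ s₁ p : ℝ≥0∞) (hp : 0 < p)
    (hps₀ : p ≤ s₀) (hps₁ : p ≤ s₁)
    (hinterp : 1 / s = ENNReal.ofReal (1 - θ) * (1 / s₀) + ENNReal.ofReal θ * (1 / s₁)) :
    (conjIdx p s)⁻¹ = ENNReal.ofReal (1 - θ) * (conjIdx p s₀)⁻¹
      + ENNReal.ofReal θ * (conjIdx p s₁)⁻¹ := by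
  simp only [conjIdx, inv_inv]
  have ha : 1 / p ≠ ∞ := by simp [hp.ne']
  have hb : 1 / s₀ ≤ 1 / p := by gcongr
  have hc : 1 / s₁ ≤ 1 / p := by gcongr
  rw [hinterp]
  generalize 1 / p = a at *
  generalize 1 / s₀ = b at *
  generalize 1 / s₁ = c at *
  have hb' : b ≠ ∞ := ne_top_of_le_ne_top ha hb
  have hc' : c ≠ ∞ := ne_top_of_le_ne_top ha hc
  have one : ENNReal.ofReal (1 - θ) + ENNReal.ofReal θ = 1 := by
    rw [← ENNReal.ofReal_add (by linarith) hθ0.le]; simp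
  have key : a = (ENNReal.ofReal (1 - θ) * (a - b) + ENNReal.ofReal θ * (a - c))
      + (ENNReal.ofReal (1 - θ) * b + ENNReal.ofReal θ * c) := by
    calc a = ENNReal.ofReal (1 - θ) * a + ENNReal.ofReal θ * a := by
            rw [← add_mul, one, one_mul]
      _ = ENNReal.ofReal (1 - θ) * ((a - b) + b) + ENNReal.ofReal θ * ((a - c) + c) := by
            rw [tsub_add_cancel_of_le hb, tsub_add_cancel_of_le hc]
      _ = _ := by ring
  refine ENNReal.sub_eq_of_eq_add ?_ key
  finiteness

lemma aux_weak_ne_top {X : Type*} [MetricSpace X] (x₀ : X) (p : ℝ≥0∞) {m : ℕ}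
    (σ : Fin m → ℝ) (x' x'' : Fin m → X) : weakNorm x₀ p σ x' x'' ≠ ∞ := by
  have h : weakNorm x₀ p σ x' x'' ≤ strongNorm p σ x' x'' := by
    refine iSup₂_le fun f hf => ?_
    refine eLpNorm_mono fun j => ?_
    rw [norm_mul, norm_mul]
    gcongr
    have := hf.1.dist_le_mul (x' j) (x'' j)
    rw [Real.dist_eq] at this
    simpa using this
  refine ne_top_of_le_ne_top ?_ h
  exact (MemLp.of_discrete (p := p) (μ := Measure.count)
    (f := fun j : Fin m => σ j * dist (x' j) (x'' j))).2.ne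

lemma aux_mixed_ne_top {X : Type*} [MetricSpace X] (x₀ : X) (s q : ℝ≥0∞) {m : ℕ}
    (σ : Fin m → ℝ) (x' x'' : Fin m → X) : mixedNorm x₀ s q σ x' x'' ≠ ∞ := by
  have h : mixedNorm x₀ s q σ x' x'' ≤ _ := iInf₂_le (fun _ => (1 : ℝ)) (fun _ => one_ne_zero)
  refine ne_top_of_le_ne_top (ENNReal.mul_ne_top ?_ (aux_weak_ne_top _ _ _ _ _)) h
  exact (MemLp.of_discrete (p := conjIdx q s) (μ := Measure.count)
    (f := fun _ : Fin m => (1 : ℝ))).2.ne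

lemma aux_inf (θ : ℝ) (hθ0 : 0 < θ) (hθ1 : θ < 1) (a b c : ℝ≥0∞) (ha : a ≠ ∞) (hb : b ≠ ∞)
    (h : ∀ a' > a, ∀ b' > b, c ≤ a' ^ (1 - θ) * b' ^ θ) : c ≤ a ^ (1 - θ) * b ^ θ := by
  have h1 : 0 < 1 - θ := by linarith
  have h1n := h1.ne'
  have hn := hθ0.ne'
  refine ENNReal.le_mul_of_forall_lt (.inr (by finiteness)) (.inl (by finiteness)) ?_
  intro a' ha' b' hb'
  have := h (a' ^ (1 - θ)⁻¹) ?_ (b' ^ θ⁻¹) ?_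
  · rwa [ENNReal.rpow_inv_rpow h1n, ENNReal.rpow_inv_rpow hn] at this
  · exact (ENNReal.lt_rpow_inv_iff h1).2 ha'
  · exact (ENNReal.lt_rpow_inv_iff hθ0).2 hb'

lemma aux_mixed {X : Type*} [MetricSpace X] (x₀ : X)
    (θ : ℝ) (hθ0 : 0 < θ) (hθ1 : θ < 1) (s s₀ s₁ p : ℝ≥0∞) (hp : 0 < p)
    (hps₀ : p ≤ s₀) (hps₁ : p ≤ s₁)
    (hinterp : 1 / s = ENNReal.ofReal (1 - θ) * (1 / s₀) + ENNReal.ofReal θ * (1 / s₁))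
    {m : ℕ} (σ : Fin m → ℝ) (x' x'' : Fin m → X) :
    mixedNorm x₀ s p σ x' x'' ≤
      mixedNorm x₀ s₀ p σ x' x'' ^ (1 - θ) * mixedNorm x₀ s₁ p σ x' x'' ^ θ := by
  have h1 : 0 < 1 - θ := by linarith
  refine aux_inf θ hθ0 hθ1 _ _ _ (aux_mixed_ne_top _ _ _ _ _ _) (aux_mixed_ne_top _ _ _ _ _ _) ?_
  intro a' ha' b' hb'
  simp only [mixedNorm, gt_iff_lt, iInf_lt_iff] at ha' hb'
  obtain ⟨t, ht, hta⟩ := ha'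
  obtain ⟨v, hv, hvb⟩ := hb'
  have hpos : ∀ j, 0 < |t j| ^ (1 - θ) * |v j| ^ θ := fun j =>
    mul_pos (Real.rpow_pos_of_pos (abs_pos.2 (ht j)) _) (Real.rpow_pos_of_pos (abs_pos.2 (hv j)) _)
  have hm : mixedNorm x₀ s p σ x' x'' ≤ _ :=
    iInf₂_le (fun j => |t j| ^ (1 - θ) * |v j| ^ θ) (fun j => (hpos j).ne')
  refine hm.trans ?_
  have A := aux_holder θ hθ0 hθ1 _ _ _ (aux_conj θ hθ0 hθ1 s s₀ s₁ p hp hps₀ hps₁ hinterp)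
    (fun j => |t j| ^ (1 - θ) * |v j| ^ θ) t v (fun j => abs_of_pos (hpos j))
  have B : weakNorm x₀ s (fun j => σ j / (|t j| ^ (1 - θ) * |v j| ^ θ)) x' x'' ≤
      weakNorm x₀ s₀ (fun j => σ j / t j) x' x'' ^ (1 - θ)
        * weakNorm x₀ s₁ (fun j => σ j / v j) x' x'' ^ θ := by
    refine iSup₂_le fun f hf => ?_
    refine (aux_holder θ hθ0 hθ1 s s₀ s₁ (by simpa using hinterp) _
      (fun j => σ j / t j * (f (x' j) - f (x'' j)))
      (fun j => σ j / v j * (f (x' j) - f (x'' j))) ?_).trans ?_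
    · intro j
      simp only [abs_mul, abs_div]
      rw [abs_of_nonneg (a := |t j| ^ (1 - θ)) (by positivity),
        abs_of_nonneg (a := |v j| ^ θ) (by positivity),
        Real.mul_rpow (by positivity) (by positivity), Real.mul_rpow (by positivity) (by positivity),
        Real.div_rpow (by positivity) (by positivity), Real.div_rpow (by positivity) (by positivity)]
      have e : ∀ y : ℝ, 0 ≤ y → y = y ^ (1 - θ) * y ^ θ := fun y hy => by
        rw [← Real.rpow_add_of_nonneg hy h1.le hθ0.le]; simp
      conv_lhs => rw [e |σ j| (abs_nonneg _), e |f (x' j) - f (x'' j)| (abs_nonneg _)]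
      rw [mul_div_mul_comm]
      ring
    · gcongr
      · exact le_iSup₂_of_le f hf le_rfl
      · exact le_iSup₂_of_le f hf le_rfl
  calc _ ≤ _ := mul_le_mul' A B
    _ = (eLpNorm t (conjIdx p s₀) Measure.count
          * weakNorm x₀ s₀ (fun j => σ j / t j) x' x'') ^ (1 - θ)
        * (eLpNorm v (conjIdx p s₁) Measure.count
          * weakNorm x₀ s₁ (fun j => σ j / v j) x' x'') ^ θ := by
        rw [ENNReal.mul_rpow_of_nonneg _ _ h1.le, ENNReal.mul_rpow_of_nonneg _ _ hθ0.le]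
        ring
    _ ≤ _ := by gcongr

/-- general 'interpolation style' theorem: if `0 < θ < 1`,
`0 < p ≤ s, s₀, s₁ ≤ ∞`, `0 < r ≤ p` and `1/s = (1-θ)/s₀ + θ/s₁`, then for every Lipschitz
map `S` which is both Lipschitz `(m^L(s₀;p),r)`- and `(m^L(s₁;p),r)`-summing, `S` is
Lipschitz `(m^L(s;p),r)`-summing with
`π^L_{(m^L(s;p),r)}(S) ≤ π^L_{(m^L(s₀;p),r)}(S)^{1-θ} ⬝ π^L_{(m^L(s₁;p),r)}(S)^{θ}`. -/
theorem stmt15 {X Y : Type*} [MetricSpace X] [MetricSpace Y] (x₀ : X) (y₀ : Y)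
    (θ : ℝ) (hθ0 : 0 < θ) (hθ1 : θ < 1)
    (s s₀ s₁ p r : ℝ≥0∞) (hp : 0 < p) (hps : p ≤ s) (hps₀ : p ≤ s₀) (hps₁ : p ≤ s₁)
    (hr : 0 < r) (hrp : r ≤ p)
    (hinterp : 1 / s = ENNReal.ofReal (1 - θ) * (1 / s₀) + ENNReal.ofReal θ * (1 / s₁))
    (S : X → Y) (K : ℝ≥0) (hS : LipschitzWith K S)
    (h0 : LipMixedP x₀ y₀ s₀ p r S) (h1 : LipMixedP x₀ y₀ s₁ p r S) :
    LipMixedP x₀ y₀ s p r S ∧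
    lipMixedPNorm x₀ y₀ s p r S ≤
      lipMixedPNorm x₀ y₀ s₀ p r S ^ (1 - θ) * lipMixedPNorm x₀ y₀ s₁ p r S ^ θ := by
  have h1' : 0 < 1 - θ := by linarith
  have key : ∀ C₀ C₁ : ℝ≥0∞,
      (∀ (m : ℕ) (σ : Fin m → ℝ) (x' x'' : Fin m → X),
        mixedNorm y₀ s₀ p σ (S ∘ x') (S ∘ x'') ≤ C₀ * weakNorm x₀ r σ x' x'') →
      (∀ (m : ℕ) (σ : Fin m → ℝ) (x' x'' : Fin m → X),
        mixedNorm y₀ s₁ p σ (S ∘ x') (S ∘ x'') ≤ C₁ * weakNorm x₀ r σ x' x'') →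
      ∀ (m : ℕ) (σ : Fin m → ℝ) (x' x'' : Fin m → X),
        mixedNorm y₀ s p σ (S ∘ x') (S ∘ x'') ≤
          (C₀ ^ (1 - θ) * C₁ ^ θ) * weakNorm x₀ r σ x' x'' := by
    intro C₀ C₁ H₀ H₁ m σ x' x''
    refine (aux_mixed y₀ θ hθ0 hθ1 s s₀ s₁ p hp hps₀ hps₁ hinterp σ _ _).trans ?_
    calc _ ≤ (C₀ * weakNorm x₀ r σ x' x'') ^ (1 - θ) * (C₁ * weakNorm x₀ r σ x' x'') ^ θ := by
          gcongr
          · exact H₀ m σ x' x''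
          · exact H₁ m σ x' x''
      _ = (C₀ ^ (1 - θ) * C₁ ^ θ) *
          (weakNorm x₀ r σ x' x'' ^ (1 - θ) * weakNorm x₀ r σ x' x'' ^ θ) := by
          rw [ENNReal.mul_rpow_of_nonneg _ _ h1'.le, ENNReal.mul_rpow_of_nonneg _ _ hθ0.le]
          ring
      _ = _ := by
          rw [← ENNReal.rpow_add_of_nonneg _ _ h1'.le hθ0.le]
          simp
  obtain ⟨C₀, H₀⟩ := h0
  obtain ⟨C₁, H₁⟩ := h1
  constructor
  · refine ⟨C₀ ^ (1 - θ) * C₁ ^ θ, ?_⟩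
    have := key C₀ C₁ H₀ H₁
    rw [← ENNReal.coe_rpow_of_nonneg _ h1'.le, ← ENNReal.coe_rpow_of_nonneg _ hθ0.le,
      ← ENNReal.coe_mul] at this
    exact this
  · have t0 : lipMixedPNorm x₀ y₀ s₀ p r S ≠ ∞ :=
      ne_top_of_le_ne_top ENNReal.coe_ne_top (sInf_le H₀)
    have t1 : lipMixedPNorm x₀ y₀ s₁ p r S ≠ ∞ :=
      ne_top_of_le_ne_top ENNReal.coe_ne_top (sInf_le H₁)
    refine aux_inf θ hθ0 hθ1 _ _ _ t0 t1 ?_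
    intro a' ha' b' hb'
    obtain ⟨D₀, G₀, l₀⟩ := sInf_lt_iff.1 ha'
    obtain ⟨D₁, G₁, l₁⟩ := sInf_lt_iff.1 hb'
    have hk : lipMixedPNorm x₀ y₀ s p r S ≤ D₀ ^ (1 - θ) * D₁ ^ θ := sInf_le (key D₀ D₁ G₀ G₁)
    refine hk.trans ?_
    gcongr
end
end

section
/- Let X and Y be pointed metric spaces with base points x₀ and y₀, and let 0 < p ≤ q < s < 1. Then every Lipschitz map S : X → Y with S(x₀) = y₀ is Lipschitz (m^L(s;q),p)-summing; that is, Π^L_{(m^L(s;q),p)}(X,Y) ∩ L_{x₀}(X,Y) = L_{x₀}(X,Y). -/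
open MeasureTheory ENNReal NNReal

noncomputable section

def sgnB (b : Bool) : ℝ := if b then 1 else -1

lemma abs_sgnB (b : Bool) : |sgnB b| = 1 := by cases b <;> simp [sgnB]

lemma signs_aux {N : ℕ} (y : Fin N → ℝ) {q : ℝ} (hq : 0 < q) (hq1 : q ≤ 1) (k : Fin N) :
    (2:ℝ) ^ N * |y k| ^ q ≤ 2 * ∑ e : Fin N → Bool, |∑ i, sgnB (e i) * y i| ^ q := by
  classical
  set flip : (Fin N → Bool) → (Fin N → Bool) := fun e => Function.update e k (!(e k)) with hflip
  have hinv : Function.Involutive flip := by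
    intro e
    simp [hflip]
  have h1 : ∑ e : Fin N → Bool, |∑ i, sgnB (e i) * y i| ^ q
      = ∑ e : Fin N → Bool, |∑ i, sgnB (flip e i) * y i| ^ q :=
    (Equiv.sum_comp hinv.toPerm (fun e : Fin N → Bool => |∑ i, sgnB (e i) * y i| ^ q)).symm
  have h2 : ∀ e : Fin N → Bool, |y k| ^ q ≤
      |∑ i, sgnB (e i) * y i| ^ q + |∑ i, sgnB (flip e i) * y i| ^ q := by
    intro e
    have hd : ∑ i, sgnB (e i) * y i - ∑ i, sgnB (flip e i) * y i = 2 * (sgnB (e k) * y k) := by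
      rw [← Finset.sum_sub_distrib, Finset.sum_eq_single k]
      · simp only [hflip, Function.update_self]
        cases e k <;> simp [sgnB] <;> ring
      · intro i _ hi
        simp [hflip, Function.update_of_ne hi]
      · simp
    have h3 : |y k| ≤ |∑ i, sgnB (e i) * y i| + |∑ i, sgnB (flip e i) * y i| := by
      have := abs_sub (∑ i, sgnB (e i) * y i) (∑ i, sgnB (flip e i) * y i)
      rw [hd, abs_mul, abs_mul, abs_sgnB] at this
      have h2 : |(2:ℝ)| = 2 := by norm_num
      rw [h2] at this
      have := abs_nonneg (y k)
      linarith
    calc |y k| ^ q ≤ (|∑ i, sgnB (e i) * y i| + |∑ i, sgnB (flip e i) * y i|) ^ q :=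
          Real.rpow_le_rpow (abs_nonneg _) h3 hq.le
      _ ≤ _ := Real.rpow_add_le_add_rpow (abs_nonneg _) (abs_nonneg _) hq.le hq1
  calc (2:ℝ) ^ N * |y k| ^ q = ∑ e : Fin N → Bool, |y k| ^ q := by simp
    _ ≤ ∑ e : Fin N → Bool, (|∑ i, sgnB (e i) * y i| ^ q + |∑ i, sgnB (flip e i) * y i| ^ q) :=
        Finset.sum_le_sum fun e _ => h2 e
    _ = _ := by rw [Finset.sum_add_distrib, ← h1]; ring

lemma count_aux {N : ℕ} {Z : ℝ} (hZ0 : 0 ≤ Z) (hZ : Z ≤ N) :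
    Z - 1 ≤ ∑ k : Fin N, (if ((k : ℕ) : ℝ) + 1 ≤ Z then (1:ℝ) else 0) := by
  rw [Fin.sum_univ_eq_sum_range (fun k : ℕ => if (k : ℝ) + 1 ≤ Z then (1:ℝ) else 0) N]
  have hf : ⌊Z⌋₊ ≤ N := by
    have := Nat.floor_le_floor hZ
    simpa using this
  calc Z - 1 ≤ (⌊Z⌋₊ : ℝ) := by linarith [Nat.lt_floor_add_one Z]
    _ = ∑ k ∈ Finset.range ⌊Z⌋₊, (1:ℝ) := by simp
    _ = ∑ k ∈ Finset.range ⌊Z⌋₊, (if (k : ℝ) + 1 ≤ Z then (1:ℝ) else 0) := by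
        refine Finset.sum_congr rfl fun k hk => ?_
        rw [if_pos]
        have h1 : k + 1 ≤ ⌊Z⌋₊ := Finset.mem_range.1 hk
        have h2 : ((k + 1 : ℕ) : ℝ) ≤ ⌊Z⌋₊ := by exact_mod_cast h1
        push_cast at h2
        linarith [Nat.floor_le hZ0]
    _ ≤ _ := by
        apply Finset.sum_le_sum_of_subset_of_nonneg
        · intro x hx
          simp only [Finset.mem_range] at *
          omega
        · intros
          split_ifs <;> norm_num

lemma samp_aux {ι : Type*} [Fintype ι] (l : ι → ℝ) (hl : ∀ i, 0 ≤ l i) (hl1 : ∑ i, l i = 1)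
    {N : ℕ} (Z : ι → ℝ) (hZ0 : ∀ i, 0 ≤ Z i) (hZ : ∀ i, Z i ≤ N) (hE : ∑ i, l i * Z i = 2) :
    ∏ k : Fin N, ∑ i, l i * (if ((k : ℕ) : ℝ) + 1 ≤ Z i then (0:ℝ) else 1) ≤ 1 / 2 := by
  have h1 : ∀ k : Fin N, ∑ i, l i * (if ((k : ℕ) : ℝ) + 1 ≤ Z i then (0:ℝ) else 1)
      = 1 - ∑ i, l i * (if ((k : ℕ) : ℝ) + 1 ≤ Z i then (1:ℝ) else 0) := by
    intro k
    rw [eq_sub_iff_add_eq, ← Finset.sum_add_distrib]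
    refine Eq.trans (Finset.sum_congr rfl fun i _ => ?_) hl1
    split_ifs <;> ring
  have h2 : (1:ℝ) ≤ ∑ k : Fin N, ∑ i, l i * (if ((k : ℕ) : ℝ) + 1 ≤ Z i then (1:ℝ) else 0) := by
    rw [Finset.sum_comm]
    calc (1:ℝ) = ∑ i, l i * (Z i - 1) := by
          simp only [mul_sub, mul_one, Finset.sum_sub_distrib, hE, hl1]; norm_num
      _ ≤ _ := by
          refine Finset.sum_le_sum fun i _ => ?_
          rw [← Finset.mul_sum]
          exact mul_le_mul_of_nonneg_left (count_aux (hZ0 i) (hZ i)) (hl i)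
  calc _ ≤ ∏ k : Fin N, Real.exp (-∑ i, l i * (if ((k : ℕ) : ℝ) + 1 ≤ Z i then (1:ℝ) else 0)) := by
        refine Finset.prod_le_prod (fun k _ => ?_) (fun k _ => ?_)
        · refine Finset.sum_nonneg fun i _ => mul_nonneg (hl i) ?_
          split_ifs <;> norm_num
        · rw [h1]
          exact Real.one_sub_le_exp_neg _
    _ = Real.exp (-∑ k : Fin N, ∑ i, l i * (if ((k : ℕ) : ℝ) + 1 ≤ Z i then (1:ℝ) else 0)) := by
        rw [← Real.exp_sum, Finset.sum_neg_distrib]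
    _ ≤ Real.exp (-1) := Real.exp_le_exp.2 (by linarith)
    _ ≤ 1 / 2 := by
        rw [Real.exp_neg, one_div]
        apply inv_anti₀ (by norm_num)
        linarith [Real.add_one_le_exp (1:ℝ)]

lemma samp_lower {ι : Type*} [Fintype ι] (l : ι → ℝ) (hl : ∀ i, 0 ≤ l i) (hl1 : ∑ i, l i = 1)
    {q s : ℝ} (hq : 0 < q) (hqs : q < s) (hs : s < 1) {N : ℕ} (b : ι → ℝ)
    (hN : 0 < ∑ i, l i * |b i| ^ s → ∀ i, |b i| ^ s ≤ N * ((∑ i, l i * |b i| ^ s) / 2)) :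
    (2:ℝ) ^ N * ((∑ i, l i * |b i| ^ s) / 2) ^ (q / s) ≤
      4 * ∑ I : Fin N → ι, (∏ k, l (I k)) * ∑ e : Fin N → Bool,
        |∑ k, sgnB (e k) * ((((k : ℕ) : ℝ) + 1) ^ (-1 / s) * b (I k))| ^ q := by
  classical
  have hs0 : 0 < s := hq.trans hqs
  set B := ∑ i, l i * |b i| ^ s with hB
  have hB0 : 0 ≤ B := Finset.sum_nonneg fun i _ => mul_nonneg (hl i) (by positivity)
  have hR0 : 0 ≤ 4 * ∑ I : Fin N → ι, (∏ k, l (I k)) * ∑ e : Fin N → Bool,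
        |∑ k, sgnB (e k) * ((((k : ℕ) : ℝ) + 1) ^ (-1 / s) * b (I k))| ^ q := by
    refine mul_nonneg (by norm_num) (Finset.sum_nonneg fun I _ => mul_nonneg
      (Finset.prod_nonneg fun k _ => hl _) (Finset.sum_nonneg fun e _ => by positivity))
  rcases hB0.eq_or_lt with h0 | hBpos
  · rw [← h0]
    have : ((0:ℝ) / 2) ^ (q / s) = 0 := by
      rw [zero_div, Real.zero_rpow]; positivity
    rw [this, mul_zero]
    exact hR0
  have hB2 : 0 < B / 2 := by positivity
  set Z : ι → ℝ := fun i => |b i| ^ s / (B / 2) with hZ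
  have hs1 := samp_aux l hl hl1 (N := N) Z (fun i => by positivity)
    (fun i => by rw [hZ]; exact (div_le_iff₀ hB2).2 (hN hBpos i))
    (by
      simp only [hZ, mul_div_assoc']
      rw [← Finset.sum_div, ← hB]
      field_simp)
  have hone : ∑ I : Fin N → ι, ∏ k, l (I k) = 1 := by
    rw [← Fintype.piFinset_univ, ← Finset.prod_univ_sum]
    simp [hl1]
  rw [Finset.prod_univ_sum, Fintype.piFinset_univ] at hs1
  have hpt : ∀ I : Fin N → ι, (2:ℝ) ^ N * (B / 2) ^ (q / s) *
      (1 - ∏ k : Fin N, (if ((k : ℕ) : ℝ) + 1 ≤ Z (I k) then (0:ℝ) else 1)) ≤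
      2 * ∑ e : Fin N → Bool,
        |∑ k, sgnB (e k) * ((((k : ℕ) : ℝ) + 1) ^ (-1 / s) * b (I k))| ^ q := by
    intro I
    by_cases h : ∃ k : Fin N, ((k : ℕ) : ℝ) + 1 ≤ Z (I k)
    · obtain ⟨k, hk⟩ := h
      rw [Finset.prod_eq_zero (Finset.mem_univ k) (by rw [if_pos hk]), sub_zero, mul_one]
      refine le_trans ?_ (signs_aux (fun k : Fin N => (((k : ℕ) : ℝ) + 1) ^ (-1 / s) * b (I k))
        hq (by linarith) k)
      apply mul_le_mul_of_nonneg_left _ (by positivity)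
      have hk1 : (0:ℝ) < ((k : ℕ) : ℝ) + 1 := by positivity
      have h3 : B / 2 ≤ (|(((k : ℕ) : ℝ) + 1) ^ (-1 / s) * b (I k)|) ^ s := by
        rw [abs_mul, abs_of_pos (Real.rpow_pos_of_pos hk1 _),
          Real.mul_rpow (by positivity) (by positivity), ← Real.rpow_mul hk1.le]
        rw [div_mul_cancel₀ _ hs0.ne', Real.rpow_neg_one]
        rw [hZ] at hk
        have := (le_div_iff₀ hB2).1 hk
        rw [inv_mul_eq_div, le_div_iff₀ hk1]
        linarith
      have h4 := Real.rpow_le_rpow hB2.le h3 (by positivity : 0 ≤ q / s)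
      rwa [← Real.rpow_mul (abs_nonneg _), mul_div_cancel₀ _ hs0.ne'] at h4
    · push Not at h
      have : ∏ k : Fin N, (if ((k : ℕ) : ℝ) + 1 ≤ Z (I k) then (0:ℝ) else 1) = 1 :=
        Finset.prod_eq_one fun k _ => by rw [if_neg (not_le.2 (h k))]
      rw [this, sub_self, mul_zero]
      positivity
  have hsum := Finset.sum_le_sum (s := Finset.univ) fun (I : Fin N → ι) _ =>
    mul_le_mul_of_nonneg_left (hpt I) (Finset.prod_nonneg fun k (_ : k ∈ Finset.univ) => hl (I k))
  have hL : ∑ I : Fin N → ι, (∏ k, l (I k)) * ((2:ℝ) ^ N * (B / 2) ^ (q / s) *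
      (1 - ∏ k : Fin N, (if ((k : ℕ) : ℝ) + 1 ≤ Z (I k) then (0:ℝ) else 1)))
      = (2:ℝ) ^ N * (B / 2) ^ (q / s) * (1 - ∑ I : Fin N → ι,
        ∏ k : Fin N, l (I k) * (if ((k : ℕ) : ℝ) + 1 ≤ Z (I k) then (0:ℝ) else 1)) := by
    have gen : ∀ (c : ℝ) (P Q : (Fin N → ι) → ℝ), ∑ I, P I = 1 →
        ∑ I, P I * (c * (1 - Q I)) = c * (1 - ∑ I, P I * Q I) := by
      intro c P Q hP
      rw [← hP, ← Finset.sum_sub_distrib, Finset.mul_sum, hP]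
      exact Finset.sum_congr rfl fun I _ => by ring
    simp only [Finset.prod_mul_distrib]
    exact gen _ _ _ hone
  rw [hL] at hsum
  have hR : ∑ I : Fin N → ι, (∏ k, l (I k)) * (2 * ∑ e : Fin N → Bool,
        |∑ k, sgnB (e k) * ((((k : ℕ) : ℝ) + 1) ^ (-1 / s) * b (I k))| ^ q)
      = 2 * ∑ I : Fin N → ι, (∏ k, l (I k)) * ∑ e : Fin N → Bool,
        |∑ k, sgnB (e k) * ((((k : ℕ) : ℝ) + 1) ^ (-1 / s) * b (I k))| ^ q := by
    rw [Finset.mul_sum]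
    exact Finset.sum_congr rfl fun I _ => by ring
  rw [hR] at hsum
  have hpos : 0 ≤ (2:ℝ) ^ N * (B / 2) ^ (q / s) := by positivity
  nlinarith

lemma key_aux {ι : Type*} [Fintype ι] {m : ℕ} (l : ι → ℝ) (hl : ∀ i, 0 ≤ l i)
    (hl1 : ∑ i, l i = 1) {q s : ℝ} (hq : 0 < q) (hqs : q < s) (hs : s < 1)
    (a : ι → Fin m → ℝ) (w : ℝ)
    (H : ∀ (N : ℕ) (y : Fin N → ℝ) (I : Fin N → ι),
      ∑ j, |∑ k, y k * a (I k) j| ^ q ≤ (∑ k, |y k|) ^ q * w) (hw : 0 ≤ w) :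
    ∑ j, (∑ i, l i * |a i j| ^ s) ^ (q / s) ≤
      2 ^ (q / s) * 4 * (∑' n : ℕ, ((n : ℝ) + 1) ^ (-1 / s)) ^ q * w := by
  classical
  have hs0 : 0 < s := hq.trans hqs
  have hsum : Summable (fun n : ℕ => ((n : ℝ) + 1) ^ (-1 / s)) := by
    have h1 : Summable (fun n : ℕ => (n : ℝ) ^ (-1 / s)) := by
      rw [Real.summable_nat_rpow, neg_div, neg_lt_neg_iff, lt_div_iff₀ hs0]
      linarith
    have := (_root_.summable_nat_add_iff 1).2 h1
    simpa using this
  set ζ := ∑' n : ℕ, ((n : ℝ) + 1) ^ (-1 / s) with hζ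
  have hNex : ∃ N : ℕ, ∀ j, 0 < ∑ i, l i * |a i j| ^ s → ∀ i,
      |a i j| ^ s ≤ N * ((∑ i, l i * |a i j| ^ s) / 2) := by
    have : ∀ᶠ N : ℕ in Filter.atTop, ∀ j, 0 < ∑ i, l i * |a i j| ^ s → ∀ i,
      |a i j| ^ s ≤ N * ((∑ i, l i * |a i j| ^ s) / 2) := by
      rw [Filter.eventually_all]
      intro j
      by_cases hB : 0 < ∑ i, l i * |a i j| ^ s
      · simp only [hB, true_imp_iff]
        rw [Filter.eventually_all]
        intro i
        filter_upwards [Filter.eventually_ge_atTop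
          ⌈|a i j| ^ s / ((∑ i, l i * |a i j| ^ s) / 2)⌉₊] with N hN
        rw [← div_le_iff₀ (by positivity)]
        exact Nat.ceil_le.1 hN
      · simp [hB]
    exact this.exists
  obtain ⟨N, hN⟩ := hNex
  have hone : ∑ I : Fin N → ι, ∏ k, l (I k) = 1 := by
    rw [← Fintype.piFinset_univ, ← Finset.prod_univ_sum]
    simp [hl1]
  have h1 := Finset.sum_le_sum (s := Finset.univ) fun (j : Fin m) _ =>
    samp_lower l hl hl1 hq hqs hs (fun i => a i j) (hN j)
  have hζN : ∀ e : Fin N → Bool,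
      ∑ k : Fin N, |sgnB (e k) * (((k : ℕ) : ℝ) + 1) ^ (-1 / s)| ≤ ζ := by
    intro e
    have : ∀ k : Fin N, |sgnB (e k) * (((k : ℕ) : ℝ) + 1) ^ (-1 / s)|
        = (((k : ℕ) : ℝ) + 1) ^ (-1 / s) := by
      intro k
      rw [abs_mul, abs_sgnB, one_mul, abs_of_nonneg (by positivity)]
    simp only [this]
    rw [Fin.sum_univ_eq_sum_range (fun k : ℕ => ((k : ℝ) + 1) ^ (-1 / s)) N]
    exact hsum.sum_le_tsum _ fun i _ => by positivity
  have h2 : ∀ (I : Fin N → ι) (e : Fin N → Bool),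
      ∑ j, |∑ k : Fin N, sgnB (e k) * ((((k : ℕ) : ℝ) + 1) ^ (-1 / s) * a (I k) j)| ^ q
        ≤ ζ ^ q * w := by
    intro I e
    have := H N (fun k => sgnB (e k) * (((k : ℕ) : ℝ) + 1) ^ (-1 / s)) I
    simp only [mul_assoc] at this
    refine this.trans (mul_le_mul_of_nonneg_right ?_ hw)
    exact Real.rpow_le_rpow (Finset.sum_nonneg fun _ _ => abs_nonneg _) (hζN e) hq.le
  have h3 : ∑ j, 4 * ∑ I : Fin N → ι, (∏ k, l (I k)) * ∑ e : Fin N → Bool,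
        |∑ k : Fin N, sgnB (e k) * ((((k : ℕ) : ℝ) + 1) ^ (-1 / s) * a (I k) j)| ^ q
      ≤ 4 * (2 ^ N * (ζ ^ q * w)) := by
    rw [← Finset.mul_sum, Finset.sum_comm]
    refine mul_le_mul_of_nonneg_left ?_ (by norm_num)
    calc _ ≤ ∑ I : Fin N → ι, (∏ k, l (I k)) * (2 ^ N * (ζ ^ q * w)) := by
          refine Finset.sum_le_sum fun I _ => ?_
          rw [← Finset.mul_sum, Finset.sum_comm]
          refine mul_le_mul_of_nonneg_left ?_ (Finset.prod_nonneg fun k _ => hl _)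
          refine (Finset.sum_le_sum fun e _ => h2 I e).trans ?_
          simp
      _ = _ := by rw [← Finset.sum_mul, hone, one_mul]
  have h4 := h1.trans h3
  rw [← Finset.mul_sum] at h4
  have h5 : ∑ j, ((∑ i, l i * |a i j| ^ s) / 2) ^ (q / s) ≤ 4 * (ζ ^ q * w) := by
    have : (0:ℝ) < 2 ^ N := by positivity
    refine le_of_mul_le_mul_left (a := (2:ℝ) ^ N) ?_ this
    linarith
  have h6 : ∀ j, (∑ i, l i * |a i j| ^ s) ^ (q / s)
      = 2 ^ (q / s) * ((∑ i, l i * |a i j| ^ s) / 2) ^ (q / s) := by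
    intro j
    have : 0 ≤ ∑ i, l i * |a i j| ^ s :=
      Finset.sum_nonneg fun i _ => mul_nonneg (hl i) (by positivity)
    rw [← Real.mul_rpow (by norm_num) (by positivity)]
    congr 1
    ring
  simp only [h6]
  rw [← Finset.mul_sum]
  have : (0:ℝ) ≤ 2 ^ (q / s) := by positivity
  calc _ ≤ 2 ^ (q / s) * (4 * (ζ ^ q * w)) := mul_le_mul_of_nonneg_left h5 this
    _ = _ := by ring

lemma mix_aux {m : ℕ} (K : Set (Fin m → ℝ)) (hne : K.Nonempty) (h0 : ∀ v ∈ K, ∀ j, 0 ≤ v j)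
    (R : Fin m → ℝ) (hR : ∀ v ∈ K, ∀ j, v j ≤ R j) {r D : ℝ} (hr : 0 < r) (hr1 : r < 1)
    (hD : ∀ v ∈ convexHull ℝ K, ∑ j, (v j) ^ r ≤ D) {ε : ℝ} (hε : 0 < ε) :
    ∃ u : Fin m → ℝ, (∀ j, 0 < u j) ∧ ∑ j, (u j) ^ r ≤ D + m * ε ^ r ∧
      ∀ v ∈ K, ∑ j, v j * (u j) ^ (r - 1) ≤ ∑ j, (u j) ^ r := by
  set A := closure (convexHull ℝ K) with hA
  have hsub : A ⊆ Set.Icc 0 R := by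
    refine closure_minimal (convexHull_min ?_ (convex_Icc _ _)) isClosed_Icc
    intro v hv
    exact ⟨fun j => h0 v hv j, fun j => hR v hv j⟩
  have hAc : IsCompact A := isCompact_Icc.of_isClosed_subset isClosed_closure hsub
  have hKA : K ⊆ A := (subset_convexHull ℝ K).trans subset_closure
  have hconv : Convex ℝ A := (convex_convexHull ℝ K).closure
  have hcont : Continuous (fun v : Fin m → ℝ => ∑ j, (v j + ε) ^ r) := by
    refine continuous_finsetSum _ fun j _ => ?_
    exact Continuous.rpow_const (by fun_prop) fun _ => Or.inr hr.le
  obtain ⟨z, hzA, hz⟩ := hAc.exists_isMaxOn (hne.mono hKA) hcont.continuousOn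
  have hz0 : ∀ j, 0 ≤ z j := fun j => (hsub hzA).1 j
  have hDA : ∑ j, (z j) ^ r ≤ D := by
    have hcl : IsClosed {v : Fin m → ℝ | ∑ j, (v j) ^ r ≤ D} := by
      refine isClosed_le ?_ continuous_const
      refine continuous_finsetSum _ fun j _ => ?_
      exact Continuous.rpow_const (by fun_prop) fun _ => Or.inr hr.le
    exact closure_minimal (fun v hv => hD v hv) hcl hzA
  have hu : ∀ j, 0 < z j + ε := fun j => by linarith [hz0 j]
  refine ⟨fun j => z j + ε, hu, ?_, ?_⟩
  · calc ∑ j, (z j + ε) ^ r ≤ ∑ j, ((z j) ^ r + ε ^ r) :=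
          Finset.sum_le_sum fun j _ => Real.rpow_add_le_add_rpow (hz0 j) hε.le hr.le hr1.le
      _ ≤ _ := by
          rw [Finset.sum_add_distrib]
          simp
          exact hDA
  · intro v hv
    have hder : HasDerivAt (fun t : ℝ => ∑ j, (z j + t * (v j - z j) + ε) ^ r)
        (∑ j, (v j - z j) * r * (z j + ε) ^ (r - 1)) 0 := by
      refine HasDerivAt.fun_sum fun j _ => ?_
      have h1 : HasDerivAt (fun t : ℝ => z j + t * (v j - z j) + ε) (v j - z j) 0 := by
        have := (((hasDerivAt_id (0:ℝ)).mul_const (v j - z j)).const_add (z j)).add_const ε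
        simpa using this
      have h2 := h1.rpow_const (p := r) (Or.inl (by simpa using (hu j).ne'))
      simpa using h2
    have hle : ∑ j, (v j - z j) * r * (z j + ε) ^ (r - 1) ≤ 0 := by
      have hlim := hder.hasDerivWithinAt (s := Set.Ioi 0)
      rw [hasDerivWithinAt_iff_tendsto_slope' (by simp)] at hlim
      refine le_of_tendsto hlim ?_
      filter_upwards [Ioc_mem_nhdsGT (show (0:ℝ) < 1 by norm_num)] with t ht
      rw [slope_def_field]
      refine div_nonpos_of_nonpos_of_nonneg ?_ (by linarith [ht.1])
      have hmem : (fun j => z j + t * (v j - z j)) ∈ A := by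
        have := hconv.add_smul_sub_mem hzA (hKA hv) ⟨ht.1.le, ht.2⟩
        exact this
      have := hz hmem
      simp only [Set.mem_ofPred_eq] at this
      simp only [zero_mul, add_zero]
      linarith
    have h3 : ∑ j, (v j - z j) * (z j + ε) ^ (r - 1) ≤ 0 := by
      have : ∑ j, (v j - z j) * r * (z j + ε) ^ (r - 1)
          = r * ∑ j, (v j - z j) * (z j + ε) ^ (r - 1) := by
        rw [Finset.mul_sum]
        exact Finset.sum_congr rfl fun j _ => by ring
      rw [this] at hle
      by_contra hc
      push Not at hc
      linarith [mul_pos hr hc]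
    calc ∑ j, v j * (z j + ε) ^ (r - 1)
        = ∑ j, (v j - z j) * (z j + ε) ^ (r - 1) + ∑ j, z j * (z j + ε) ^ (r - 1) := by
          rw [← Finset.sum_add_distrib]
          exact Finset.sum_congr rfl fun j _ => by ring
      _ ≤ ∑ j, z j * (z j + ε) ^ (r - 1) := by linarith
      _ ≤ ∑ j, (z j + ε) ^ r := by
          refine Finset.sum_le_sum fun j _ => ?_
          have : (z j + ε) ^ r = (z j + ε) * (z j + ε) ^ (r - 1) := by
            rw [← Real.rpow_one_add' (hu j).le (by linarith)]
            congr 1; ring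
          rw [this]
          exact mul_le_mul_of_nonneg_right (by linarith) (Real.rpow_nonneg (hu j).le _)

lemma eLp_count {m : ℕ} {p : ℝ≥0∞} (hp : p ≠ 0) (hp' : p ≠ ⊤) (g : Fin m → ℝ) :
    eLpNorm g p Measure.count = ENNReal.ofReal ((∑ j, |g j| ^ p.toReal) ^ (1 / p.toReal)) := by
  rw [eLpNorm_eq_lintegral_rpow_enorm_toReal hp hp', lintegral_count, tsum_fintype]
  have h0 : 0 < p.toReal := ENNReal.toReal_pos hp hp'
  rw [← ENNReal.ofReal_rpow_of_nonneg (Finset.sum_nonneg fun j _ => by positivity)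
    (by positivity), ENNReal.ofReal_sum_of_nonneg (fun j _ => by positivity)]
  congr 1
  refine Finset.sum_congr rfl fun j _ => ?_
  rw [← ENNReal.ofReal_rpow_of_nonneg (abs_nonneg _) h0.le, Real.enorm_eq_ofReal_abs]

lemma sum_rpow_mono {m : ℕ} {p q : ℝ} (hp : 0 < p) (hpq : p ≤ q) (g : Fin m → ℝ) {w : ℝ}
    (hw : 0 ≤ w) (h : ∑ j, |g j| ^ p ≤ w ^ p) : ∑ j, |g j| ^ q ≤ w ^ q := by
  have h1 : ∀ j, |g j| ≤ w := by
    intro j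
    have h2 := Finset.single_le_sum (f := fun j => |g j| ^ p) (fun j _ => by positivity)
      (Finset.mem_univ j)
    exact (Real.rpow_le_rpow_iff (abs_nonneg _) hw hp).1 (h2.trans h)
  have hs : ∀ x : ℝ, 0 ≤ x → x ^ q = x ^ p * x ^ (q - p) := by
    intro x hx
    rw [← Real.rpow_add' hx (by linarith)]
    congr 1; ring
  calc ∑ j, |g j| ^ q = ∑ j, |g j| ^ p * |g j| ^ (q - p) :=
        Finset.sum_congr rfl fun j _ => hs _ (abs_nonneg _)
    _ ≤ ∑ j, |g j| ^ p * w ^ (q - p) := by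
        refine Finset.sum_le_sum fun j _ => mul_le_mul_of_nonneg_left ?_ (by positivity)
        exact Real.rpow_le_rpow (abs_nonneg _) (h1 j) (by linarith)
    _ = (∑ j, |g j| ^ p) * w ^ (q - p) := by rw [Finset.sum_mul]
    _ ≤ w ^ p * w ^ (q - p) := mul_le_mul_of_nonneg_right h (by positivity)
    _ = w ^ q := (hs w hw).symm

lemma conjIdx_facts {q s : ℝ≥0∞} (hq : 0 < q) (hqs : q < s) (hs : s < 1) :
    conjIdx q s ≠ 0 ∧ conjIdx q s ≠ ⊤ ∧
      (conjIdx q s).toReal = (1 / q.toReal - 1 / s.toReal)⁻¹ := by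
  have hs0 : 0 < s := hq.trans hqs
  have hqi : 1 / q ≠ ⊤ := by simp [hq.ne']
  have hlt : 1 / s < 1 / q := by
    simpa using ENNReal.inv_lt_inv.2 hqs
  refine ⟨?_, ?_, ?_⟩
  · rw [conjIdx, Ne, ENNReal.inv_eq_zero]
    exact ENNReal.sub_ne_top hqi
  · rw [conjIdx, Ne, ENNReal.inv_eq_top]
    exact (tsub_pos_of_lt hlt).ne'
  · rw [conjIdx, ENNReal.toReal_inv, ENNReal.toReal_sub_of_le hlt.le hqi]
    simp

lemma lip_bound {X : Type*} [MetricSpace X] (x₀ : X) {p : ℝ≥0∞} (hp : p ≠ 0) (hp' : p ≠ ⊤)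
    {q : ℝ} (hpq : p.toReal ≤ q) {m : ℕ} (σ : Fin m → ℝ) (x' x'' : Fin m → X)
    (hW : weakNorm x₀ p σ x' x'' ≠ ⊤) (F : X → ℝ) (hF0 : F x₀ = 0) (L : ℝ≥0)
    (hF : LipschitzWith L F) :
    ∑ j, |σ j * (F (x' j) - F (x'' j))| ^ q ≤
      (L : ℝ) ^ q * (weakNorm x₀ p σ x' x'').toReal ^ q := by
  have hp0 : 0 < p.toReal := ENNReal.toReal_pos hp hp'
  have hq : 0 < q := hp0.trans_le hpq
  set w := (weakNorm x₀ p σ x' x'').toReal with hw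
  have hw0 : 0 ≤ w := ENNReal.toReal_nonneg
  rcases eq_or_ne L 0 with rfl | hL
  · have : ∀ j, F (x' j) - F (x'' j) = 0 := by
      intro j
      have := hF.dist_le_mul (x' j) (x'' j)
      rw [Real.dist_eq] at this
      simp only [NNReal.coe_zero, zero_mul] at this
      exact abs_nonpos_iff.1 this
    simp [this, Real.zero_rpow hq.ne']
  have hLpos : (0:ℝ) < L := by
    have : 0 < L := pos_iff_ne_zero.2 hL
    exact_mod_cast this
  set G : X → ℝ := fun x => (L : ℝ)⁻¹ * F x with hG
  have hGmem : G ∈ dualBall X x₀ := by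
    refine ⟨?_, by simp [hG, hF0]⟩
    refine LipschitzWith.of_dist_le_mul fun x y => ?_
    have h1 := hF.dist_le_mul x y
    rw [Real.dist_eq] at h1 ⊢
    simp only [hG]
    rw [← mul_sub, abs_mul, abs_of_pos (inv_pos.2 hLpos), inv_mul_le_iff₀ hLpos]
    simpa using h1
  have h2 : eLpNorm (fun j => σ j * (G (x' j) - G (x'' j))) p Measure.count
      ≤ weakNorm x₀ p σ x' x'' :=
    le_iSup₂ (f := fun f (_ : f ∈ dualBall X x₀) =>
      eLpNorm (fun j => σ j * (f (x' j) - f (x'' j))) p Measure.count) G hGmem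
  rw [eLp_count hp hp', ← ENNReal.ofReal_toReal hW, ENNReal.ofReal_le_ofReal_iff hw0] at h2
  have hS0 : 0 ≤ ∑ j, |σ j * (G (x' j) - G (x'' j))| ^ p.toReal :=
    Finset.sum_nonneg fun j _ => by positivity
  have h3 : ∑ j, |σ j * (G (x' j) - G (x'' j))| ^ p.toReal ≤ w ^ p.toReal := by
    have := Real.rpow_le_rpow (by positivity) h2 hp0.le
    rwa [← Real.rpow_mul hS0, one_div_mul_cancel hp0.ne', Real.rpow_one] at this
  have h4 := sum_rpow_mono hp0 hpq (fun j => σ j * (G (x' j) - G (x'' j))) hw0 h3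
  calc ∑ j, |σ j * (F (x' j) - F (x'' j))| ^ q
      = ∑ j, (L : ℝ) ^ q * |σ j * (G (x' j) - G (x'' j))| ^ q := by
        refine Finset.sum_congr rfl fun j _ => ?_
        rw [← Real.mul_rpow hLpos.le (abs_nonneg _)]
        congr 1
        nth_rewrite 1 [← abs_of_pos hLpos]
        rw [← abs_mul]
        congr 1
        simp only [hG]
        field_simp
    _ ≤ _ := by
        rw [← Finset.mul_sum]
        exact mul_le_mul_of_nonneg_left h4 (by positivity)

lemma lip_comb {X Y : Type*} [MetricSpace X] [MetricSpace Y] {S : X → Y} {K : ℝ≥0}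
    (hS : LipschitzWith K S) {N : ℕ} (y : Fin N → ℝ) (f : Fin N → Y → ℝ)
    (hf : ∀ k, LipschitzWith 1 (f k)) :
    LipschitzWith ((∑ k, ‖y k‖₊) * K) (fun x => ∑ k, y k * f k (S x)) := by
  refine LipschitzWith.of_dist_le_mul fun x z => ?_
  rw [Real.dist_eq, ← Finset.sum_sub_distrib]
  refine (Finset.abs_sum_le_sum_abs _ _).trans ?_
  push_cast
  rw [Finset.sum_mul, Finset.sum_mul]
  refine Finset.sum_le_sum fun k _ => ?_
  rw [← mul_sub, abs_mul, mul_assoc, Real.norm_eq_abs]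
  refine mul_le_mul_of_nonneg_left ?_ (abs_nonneg _)
  have h1 := (hf k).dist_le_mul (S x) (S z)
  have h2 := hS.dist_le_mul x z
  rw [Real.dist_eq] at h1
  simp only [NNReal.coe_one, one_mul] at h1
  exact h1.trans h2

lemma mixed_le_s17 {Y : Type*} [MetricSpace Y] (y₀ : Y) {s q : ℝ≥0∞} (hq : 0 < q) (hqs : q < s)
    (hs : s < 1) {m : ℕ} (σ : Fin m → ℝ) (z' z'' : Fin m → Y) (u : Fin m → ℝ)
    (hu : ∀ j, 0 < u j) {G : ℝ} (hG : ∑ j, (u j) ^ (q.toReal / s.toReal) ≤ G)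
    (h : ∀ f ∈ dualBall Y y₀, ∑ j, |σ j * (f (z' j) - f (z'' j))| ^ s.toReal *
      (u j) ^ (q.toReal / s.toReal - 1) ≤ ∑ j, (u j) ^ (q.toReal / s.toReal)) :
    mixedNorm y₀ s q σ z' z'' ≤ ENNReal.ofReal (G ^ (1 / q.toReal)) := by
  have hs0 : s ≠ 0 := (hq.trans hqs).ne'
  have hs' : s ≠ ⊤ := (hs.trans ENNReal.one_lt_top).ne
  have hq' : q ≠ ⊤ := (hqs.trans (hs.trans ENNReal.one_lt_top)).ne
  obtain ⟨hc0, hc1, hc⟩ := conjIdx_facts hq hqs hs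
  have hQ : 0 < q.toReal := ENNReal.toReal_pos hq.ne' hq'
  have hQS : q.toReal < s.toReal := (ENNReal.toReal_lt_toReal hq' hs').2 hqs
  set Q := q.toReal
  set R := s.toReal
  have hR : 0 < R := hQ.trans hQS
  have hcpos : 0 < 1 / Q - 1 / R := sub_pos.2 (one_div_lt_one_div_of_lt hQ hQS)
  set M := ∑ j, (u j) ^ (Q / R) with hM
  have hM0 : 0 ≤ M := Finset.sum_nonneg fun j _ => Real.rpow_nonneg (hu j).le _
  set τ : Fin m → ℝ := fun j => (u j) ^ ((1 - Q / R) / R) with hτ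
  have hτpos : ∀ j, 0 < τ j := fun j => Real.rpow_pos_of_pos (hu j) _
  have h1 : eLpNorm τ (conjIdx q s) Measure.count = ENNReal.ofReal (M ^ (1 / Q - 1 / R)) := by
    rw [eLp_count hc0 hc1, hc, one_div (1 / Q - 1 / R)⁻¹, inv_inv]
    congr 2
    refine Finset.sum_congr rfl fun j _ => ?_
    rw [abs_of_pos (hτpos j), hτ]
    simp only
    rw [← Real.rpow_mul (hu j).le]
    congr 1
    have : R - Q ≠ 0 := by linarith
    have e : (1 / Q - 1 / R) = (R - Q) / (Q * R) := by field_simp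
    rw [e]
    field_simp
  have h2 : weakNorm y₀ s (fun j => σ j / τ j) z' z'' ≤ ENNReal.ofReal (M ^ (1 / R)) := by
    refine iSup₂_le fun f hf => ?_
    rw [eLp_count hs0 hs']
    refine ENNReal.ofReal_le_ofReal (Real.rpow_le_rpow
      (Finset.sum_nonneg fun j _ => by positivity) ?_ (by positivity))
    refine le_trans (le_of_eq ?_) (h f hf)
    refine Finset.sum_congr rfl fun j _ => ?_
    have e1 : σ j / τ j * (f (z' j) - f (z'' j)) = σ j * (f (z' j) - f (z'' j)) * (τ j)⁻¹ := by
      rw [div_eq_mul_inv]; ring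
    rw [e1, abs_mul, abs_of_pos (inv_pos.2 (hτpos j)),
      Real.mul_rpow (abs_nonneg _) (inv_pos.2 (hτpos j)).le]
    congr 1
    rw [hτ]
    simp only
    rw [← Real.rpow_neg (hu j).le, ← Real.rpow_mul (hu j).le]
    congr 1
    field_simp
    ring
  calc mixedNorm y₀ s q σ z' z''
      ≤ eLpNorm τ (conjIdx q s) Measure.count * weakNorm y₀ s (fun j => σ j / τ j) z' z'' :=
        iInf₂_le (f := fun (τ : Fin m → ℝ) (_ : ∀ j, τ j ≠ 0) =>
          eLpNorm τ (conjIdx q s) Measure.count * weakNorm y₀ s (fun j => σ j / τ j) z' z'')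
          τ (fun j => (hτpos j).ne')
    _ ≤ ENNReal.ofReal (M ^ (1 / Q - 1 / R)) * ENNReal.ofReal (M ^ (1 / R)) := by
        rw [h1]; gcongr
    _ = ENNReal.ofReal (M ^ (1 / Q)) := by
        rw [← ENNReal.ofReal_mul (by positivity), ← Real.rpow_add' hM0]
        · congr 2; ring
        · rw [sub_add_cancel]; positivity
    _ ≤ _ := ENNReal.ofReal_le_ofReal (Real.rpow_le_rpow hM0 hG (by positivity))

lemma main_aux {X Y : Type*} [MetricSpace X] [MetricSpace Y] (x₀ : X) (y₀ : Y)
    (s q p : ℝ≥0∞) (hp : 0 < p) (hpq : p ≤ q) (hqs : q < s) (hs : s < 1) (S : X → Y)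
    (K : ℝ≥0) (hS : LipschitzWith K S) (hS0 : S x₀ = y₀) : LipMixedP x₀ y₀ s q p S := by
  have hq : 0 < q := hp.trans_le hpq
  have hs0 : s ≠ 0 := (hq.trans hqs).ne'
  have hs' : s ≠ ⊤ := (hs.trans ENNReal.one_lt_top).ne
  have hq' : q ≠ ⊤ := (hqs.trans (hs.trans ENNReal.one_lt_top)).ne
  have hp' : p ≠ ⊤ := ne_top_of_le_ne_top hq' hpq
  have hQ : 0 < q.toReal := ENNReal.toReal_pos hq.ne' hq'
  have hQS : q.toReal < s.toReal := (ENNReal.toReal_lt_toReal hq' hs').2 hqs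
  have hR1 : s.toReal < 1 := by
    have := (ENNReal.toReal_lt_toReal hs' ENNReal.one_ne_top).2 hs
    simpa using this
  have hPQ : p.toReal ≤ q.toReal := ENNReal.toReal_mono hq' hpq
  have hR : 0 < s.toReal := hQ.trans hQS
  set c : ℝ := 2 ^ (q.toReal / s.toReal) * 4 *
    (∑' n : ℕ, ((n : ℝ) + 1) ^ (-1 / s.toReal)) ^ q.toReal with hc
  have hc0 : 0 ≤ c := by
    have : 0 ≤ ∑' n : ℕ, ((n : ℝ) + 1) ^ (-1 / s.toReal) := tsum_nonneg fun n => by positivity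
    positivity
  have hC0 : 0 ≤ c ^ (1 / q.toReal) * K + 1 := by positivity
  obtain ⟨C, hC⟩ : ∃ C : ℝ≥0, (C : ℝ) = c ^ (1 / q.toReal) * K + 1 :=
    ⟨Real.toNNReal (c ^ (1 / q.toReal) * K + 1), Real.coe_toNNReal _ hC0⟩
  refine ⟨C, fun m σ x' x'' => ?_⟩
  by_cases hW : weakNorm x₀ p σ x' x'' = ⊤
  · rw [hW, ENNReal.mul_top]
    · exact le_top
    · rw [Ne, ENNReal.coe_eq_zero]
      intro h
      rw [h, NNReal.coe_zero] at hC
      have : 0 ≤ c ^ (1 / q.toReal) * K := by positivity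
      linarith
  set w := (weakNorm x₀ p σ x' x'').toReal with hw
  have hw0 : 0 ≤ w := ENNReal.toReal_nonneg
  set V : (Y → ℝ) → Fin m → ℝ := fun f j =>
    |σ j * (f (S (x' j)) - f (S (x'' j)))| ^ s.toReal with hV
  set D : ℝ := c * ((K : ℝ) ^ q.toReal * w ^ q.toReal) with hD
  have hD0 : 0 ≤ D := by positivity
  have hconv : ∀ v ∈ convexHull ℝ (V '' dualBall Y y₀),
      ∑ j, (v j) ^ (q.toReal / s.toReal) ≤ D := by
    intro v hv
    obtain ⟨ι, _, l, z, hl, hl1, hz, rfl⟩ := mem_convexHull_iff_exists_fintype.1 hv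
    choose f hf hfz using hz
    have := key_aux l hl hl1 hQ hQS hR1
      (fun i j => σ j * (f i (S (x' j)) - f i (S (x'' j))))
      ((K : ℝ) ^ q.toReal * w ^ q.toReal) ?_ (by positivity)
    · refine le_trans (le_of_eq ?_) this
      refine Finset.sum_congr rfl fun j _ => ?_
      congr 1
      rw [Finset.sum_apply]
      refine Finset.sum_congr rfl fun i _ => ?_
      rw [Pi.smul_apply, smul_eq_mul, ← hfz]
    · intro N y I
      have h1 := lip_bound x₀ hp.ne' hp' hPQ σ x' x'' hW
        (fun x => ∑ k, y k * f (I k) (S x)) (by simp [hS0, (hf _).2]) _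
        (lip_comb hS y (fun k => f (I k)) (fun k => (hf _).1))
      refine le_trans (le_of_eq ?_) (h1.trans (le_of_eq ?_))
      · refine Finset.sum_congr rfl fun j _ => ?_
        congr 2
        rw [← Finset.sum_sub_distrib, Finset.mul_sum]
        exact Finset.sum_congr rfl fun k _ => by ring
      · push_cast
        rw [Real.mul_rpow (by positivity) (by positivity), mul_assoc]
        rfl
  have hmix : ∀ ε : ℝ, 0 < ε → mixedNorm y₀ s q σ (S ∘ x') (S ∘ x'') ≤
      ENNReal.ofReal ((D + m * ε ^ (q.toReal / s.toReal)) ^ (1 / q.toReal)) := by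
    intro ε hε
    obtain ⟨u, hu, hu1, hu2⟩ := mix_aux (V '' dualBall Y y₀)
      ⟨_, Set.mem_image_of_mem _ (show (fun _ => (0:ℝ)) ∈ dualBall Y y₀ from
        ⟨LipschitzWith.const' 0 |>.weaken zero_le_one, rfl⟩)⟩
      (by rintro _ ⟨f, hf, rfl⟩ j; simp only [hV]; positivity)
      (fun j => (|σ j| * dist (S (x' j)) (S (x'' j))) ^ s.toReal)
      (by
        rintro _ ⟨f, hf, rfl⟩ j
        simp only [hV]
        refine Real.rpow_le_rpow (abs_nonneg _) ?_ hR.le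
        rw [abs_mul]
        refine mul_le_mul_of_nonneg_left ?_ (abs_nonneg _)
        have := hf.1.dist_le_mul (S (x' j)) (S (x'' j))
        rw [Real.dist_eq] at this
        simpa using this)
      (div_pos hQ hR) ((div_lt_one hR).2 hQS) hconv hε
    exact mixed_le_s17 y₀ hq hqs hs σ _ _ u hu hu1 fun f hf => hu2 _ ⟨f, hf, rfl⟩
  have hlim : Filter.Tendsto (fun ε : ℝ =>
      ENNReal.ofReal ((D + m * ε ^ (q.toReal / s.toReal)) ^ (1 / q.toReal)))
      (nhdsWithin 0 (Set.Ioi 0)) (nhds (ENNReal.ofReal (D ^ (1 / q.toReal)))) := by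
    have hcont : Continuous (fun ε : ℝ =>
      ENNReal.ofReal ((D + m * ε ^ (q.toReal / s.toReal)) ^ (1 / q.toReal))) := by
      refine ENNReal.continuous_ofReal.comp ?_
      refine Continuous.rpow_const ?_ fun _ => Or.inr (by positivity)
      refine continuous_const.add (continuous_const.mul ?_)
      exact Continuous.rpow_const continuous_id fun _ => Or.inr (by positivity)
    have h1 := hcont.tendsto 0
    rw [Real.zero_rpow (div_pos hQ hR).ne', mul_zero, add_zero] at h1
    exact h1.mono_left nhdsWithin_le_nhds
  have hfin : mixedNorm y₀ s q σ (S ∘ x') (S ∘ x'') ≤ ENNReal.ofReal (D ^ (1 / q.toReal)) := by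
    refine ge_of_tendsto hlim ?_
    filter_upwards [self_mem_nhdsWithin] with ε hε
    exact hmix ε hε
  refine hfin.trans ?_
  have hDe : D ^ (1 / q.toReal) = c ^ (1 / q.toReal) * K * w := by
    rw [hD, Real.mul_rpow hc0 (by positivity), ← Real.mul_rpow (by positivity) hw0,
      ← Real.rpow_mul (by positivity), mul_one_div_cancel hQ.ne', Real.rpow_one, mul_assoc]
  rw [hDe, ← ENNReal.ofReal_toReal hW, ← hw, ← ENNReal.ofReal_coe_nnreal,
    ← ENNReal.ofReal_mul (NNReal.coe_nonneg _)]
  refine ENNReal.ofReal_le_ofReal (mul_le_mul_of_nonneg_right ?_ hw0)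
  rw [hC]
  linarith

/-- for `0 < p ≤ q < s < 1`, every Lipschitz map `S : X → Y` with
`S x₀ = y₀` is Lipschitz `(m^L(s;q),p)`-summing; that is,
`Π^L_{(m^L(s;q),p)}(X,Y) ∩ L_{x₀}(X,Y) = L_{x₀}(X,Y)`. -/
theorem stmt17 {X Y : Type*} [MetricSpace X] [MetricSpace Y] (x₀ : X) (y₀ : Y)
    (s q p : ℝ≥0∞) (hp : 0 < p) (hpq : p ≤ q) (hqs : q < s) (hs : s < 1) :
    {S : X → Y | LipMixedP x₀ y₀ s q p S ∧ (∃ K : ℝ≥0, LipschitzWith K S) ∧ S x₀ = y₀}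
      = {S : X → Y | (∃ K : ℝ≥0, LipschitzWith K S) ∧ S x₀ = y₀} := by
  ext S
  constructor
  · rintro ⟨_, h⟩
    exact h
  · rintro ⟨⟨K, hK⟩, h0⟩
    exact ⟨main_aux x₀ y₀ s q p hp hpq hqs hs S K hK h0, ⟨K, hK⟩, h0⟩
end
end
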